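/- arXiv:1902.05619 — 4 statements merged into one kernel-verified Lean document; each statement's English description precedes it below -/
import Mathlib

section
/- Let V be a probability vector field satisfying (H1) and (H2), and let μ₀ ∈ 𝒫_c(ℝ^d). Then the mean velocity scheme μ̂^N converges, up to a subsequence, uniformly in time for the Wasserstein distance, to a solution of the MDE μ̇_t = V[μ_t] with initial datum μ₀. -/
open MeasureTheory Set Filter Topology Metric
open scoped ENNReal NNReal Classical

noncomputable section

abbrev Euc (d : ℕ) : Type := EuclideanSpace ℝ (Fin d)

/-- The (topological) support of a measure. -/
def msupp {X : Type*} [TopologicalSpace X] [MeasurableSpace X] (μ : Measure X) : Set X :=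
  {x | ∀ U : Set X, IsOpen U → x ∈ U → 0 < μ U}

/-- Compactly supported Borel probability measures (membership in `𝒫_c`). -/
def Pc {X : Type*} [TopologicalSpace X] [MeasurableSpace X] (μ : Measure X) : Prop :=
  IsProbabilityMeasure μ ∧ ∃ K : Set X, IsCompact K ∧ μ Kᶜ = 0

/-- A probability vector field: `π₁ ♯ V[μ] = μ`. -/
def IsPVF {d : ℕ} (V : Measure (Euc d) → Measure (Euc d × Euc d)) : Prop :=
  ∀ μ : Measure (Euc d), IsProbabilityMeasure μ →
    IsProbabilityMeasure (V μ) ∧ (V μ).map Prod.fst = μ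

/-- Solution of the measure differential equation `μ̇_t = V[μ_t]` on `[0,T]`. -/
def IsMDESol {d : ℕ} (T : ℝ) (V : Measure (Euc d) → Measure (Euc d × Euc d))
    (μ : ℝ → Measure (Euc d)) : Prop :=
  ∀ f : Euc d → ℝ, ContDiff ℝ (⊤ : ℕ∞) f → HasCompactSupport f →
    IntegrableOn (fun t => ∫ p : Euc d × Euc d, fderiv ℝ f p.1 p.2 ∂(V (μ t))) (Icc 0 T) ∧
    ∀ t ∈ Icc (0 : ℝ) T,
      (∫ x, f x ∂(μ t)) - (∫ x, f x ∂(μ 0)) =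
        ∫ s in Icc (0 : ℝ) t, (∫ p : Euc d × Euc d, fderiv ℝ f p.1 p.2 ∂(V (μ s)))

/-- 1-Wasserstein distance via the Kantorovich–Rubinstein duality. -/
def W1 {X : Type*} [MeasurableSpace X] [PseudoMetricSpace X] (μ ν : Measure X) : ℝ :=
  ⨆ f : {f : X → ℝ // LipschitzWith 1 f}, ((∫ x, f.1 x ∂μ) - ∫ x, f.1 x ∂ν)

/-- Disintegration `ν_x[·]` of a measure on a product space w.r.t. the first projection. -/
def disint {d : ℕ} (m : Measure (Euc d × Euc d)) : Euc d → Measure (Euc d) :=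
  if h : IsFiniteMeasure m then
    haveI := h
    fun x => m.condKernel x
  else fun _ => 0

/-- Barycenter of the disintegration: `x ↦ ∫ v dν_x(v)`. -/
def bary {d : ℕ} (m : Measure (Euc d × Euc d)) (x : Euc d) : Euc d :=
  ∫ v, v ∂(disint m x)


section Hypotheses

/-- Condition (H1) with a given constant `C`. -/
def H1cond {d : ℕ} (C : ℝ) (V : Measure (Euc d) → Measure (Euc d × Euc d)) : Prop :=
  ∀ μ : Measure (Euc d), Pc μ →
    ∀ p ∈ msupp (V μ), ‖p.2‖ ≤ C * (1 + ⨆ x : msupp μ, ‖(x : Euc d)‖)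

/-- Hypothesis (H1): sublinearity of the PVF. -/
def H1 {d : ℕ} (V : Measure (Euc d) → Measure (Euc d × Euc d)) : Prop :=
  ∃ C > 0, H1cond C V

/-- Hypothesis (H2): continuity of the PVF `V : 𝒫_c(ℝ^d) → 𝒫_c(Tℝ^d)` w.r.t. Wasserstein. -/
def H2 {d : ℕ} (V : Measure (Euc d) → Measure (Euc d × Euc d)) : Prop :=
  (∀ μ, Pc μ → Pc (V μ)) ∧
  ∀ μ, Pc μ → ∀ ε > 0, ∃ δ > 0, ∀ ν, Pc ν → W1 μ ν < δ → W1 (V μ) (V ν) < ε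

/-- Transference plans between two measures. -/
def Couplings {X Y : Type*} [MeasurableSpace X] [MeasurableSpace Y]
    (μ : Measure X) (ν : Measure Y) : Set (Measure (X × Y)) :=
  {π | π.map Prod.fst = μ ∧ π.map Prod.snd = ν}

/-- 1-Wasserstein distance as infimum over transference plans. -/
def Wplan {X : Type*} [MeasurableSpace X] [PseudoMetricSpace X] (μ ν : Measure X) : ℝ :=
  sInf ((fun π : Measure (X × X) => ∫ p, dist p.1 p.2 ∂π) '' Couplings μ ν)

/-- Optimal transference plans. -/
def OptCouplings {X : Type*} [MeasurableSpace X] [PseudoMetricSpace X] (μ ν : Measure X) :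
    Set (Measure (X × X)) :=
  {π | π ∈ Couplings μ ν ∧ (∫ p, dist p.1 p.2 ∂π) = Wplan μ ν}

/-- The quantity `𝒲(V₁,V₂)`: minimal fiber displacement over plans whose base marginal is
an optimal plan between the two base measures. -/
def Wfib {d : ℕ} (V₁ V₂ : Measure (Euc d × Euc d)) : ℝ :=
  sInf ((fun P : Measure ((Euc d × Euc d) × (Euc d × Euc d)) => ∫ q, ‖q.1.2 - q.2.2‖ ∂P) ''
    {P | P ∈ Couplings V₁ V₂ ∧
      P.map (fun q => (q.1.1, q.2.1)) ∈ OptCouplings (V₁.map Prod.fst) (V₂.map Prod.fst)})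

/-- Hypothesis (H3): local Lipschitz continuity of the PVF in the `μ` variable. -/
def H3 {d : ℕ} (V : Measure (Euc d) → Measure (Euc d × Euc d)) : Prop :=
  ∀ R > 0, ∃ L > 0, ∀ μ ν : Measure (Euc d), Pc μ → Pc ν →
    msupp μ ⊆ ball (0 : Euc d) R → msupp ν ⊆ ball (0 : Euc d) R →
    Wfib (V μ) (V ν) ≤ L * W1 μ ν

end Hypotheses

section Schemes

/-- The semi-discrete (in time) Lagrangian scheme at grid times `t_k = k T/N`. -/
def lagrStep {d : ℕ} (T : ℝ) (N : ℕ) (V : Measure (Euc d) → Measure (Euc d × Euc d))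
    (μ₀ : Measure (Euc d)) : ℕ → Measure (Euc d)
  | 0 => μ₀
  | k + 1 => (V (lagrStep T N V μ₀ k)).map fun p => p.1 + (T / N) • p.2

/-- Time interpolation of the semi-discrete Lagrangian scheme. -/
def lagrT {d : ℕ} (T : ℝ) (N : ℕ) (V : Measure (Euc d) → Measure (Euc d × Euc d))
    (μ₀ : Measure (Euc d)) (t : ℝ) : Measure (Euc d) :=
  if t ≤ 0 then μ₀
  else
    (V (lagrStep T N V μ₀ (⌈t / (T / N)⌉.toNat - 1))).map fun p =>
      p.1 + (t - (↑(⌈t / (T / N)⌉.toNat - 1) : ℝ) * (T / N)) • p.2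

/-- The mean velocity scheme at grid times `t_j = j T/N`. -/
def mvelStep {d : ℕ} (T : ℝ) (N : ℕ) (V : Measure (Euc d) → Measure (Euc d × Euc d))
    (μ₀ : Measure (Euc d)) : ℕ → Measure (Euc d)
  | 0 => μ₀
  | j + 1 => (mvelStep T N V μ₀ j).map fun x =>
      x + (T / N) • bary (V (mvelStep T N V μ₀ j)) x

/-- Time interpolation of the mean velocity scheme. -/
def mvelT {d : ℕ} (T : ℝ) (N : ℕ) (V : Measure (Euc d) → Measure (Euc d × Euc d))
    (μ₀ : Measure (Euc d)) (t : ℝ) : Measure (Euc d) :=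
  if t ≤ 0 then μ₀
  else
    (mvelStep T N V μ₀ (⌈t / (T / N)⌉.toNat - 1)).map fun x =>
      x + (t - (↑(⌈t / (T / N)⌉.toNat - 1) : ℝ) * (T / N)) •
        bary (V (mvelStep T N V μ₀ (⌈t / (T / N)⌉.toNat - 1))) x

end Schemes

section Wasserstein

variable {X : Type*} [MetricSpace X] [MeasurableSpace X]

theorem W1_le {μ ν : Measure X} {c : ℝ}
    (h : ∀ f : X → ℝ, LipschitzWith 1 f → |∫ x, f x ∂μ - ∫ x, f x ∂ν| ≤ c) : W1 μ ν ≤ c := by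
  have : Nonempty {f : X → ℝ // LipschitzWith 1 f} :=
    ⟨⟨fun _ => 0, LipschitzWith.const' 0⟩⟩
  exact ciSup_le fun f => (le_abs_self _).trans (h f.1 f.2)

theorem abs_integral_sub_le_mul {μ ν : Measure X} {c : ℝ}
    (h : ∀ f : X → ℝ, LipschitzWith 1 f → |∫ x, f x ∂μ - ∫ x, f x ∂ν| ≤ c)
    {L : ℝ≥0} {f : X → ℝ} (hf : LipschitzWith L f) :
    |∫ x, f x ∂μ - ∫ x, f x ∂ν| ≤ (L + 1) * c := by
  have hL : (0 : ℝ) < L + 1 := by positivity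
  have hg : LipschitzWith 1 fun x => ((L : ℝ) + 1)⁻¹ * f x := by
    refine LipschitzWith.of_dist_le_mul fun x y => ?_
    have := hf.dist_le_mul x y
    rw [Real.dist_eq] at this ⊢
    rw [← mul_sub, abs_mul, abs_of_pos (inv_pos.2 hL), inv_mul_le_iff₀ hL]
    simp only [NNReal.coe_one, one_mul]
    nlinarith [dist_nonneg (x := x) (y := y)]
  have := h _ hg
  rw [integral_const_mul, integral_const_mul, ← mul_sub, abs_mul, abs_of_pos (inv_pos.2 hL),
    inv_mul_le_iff₀ hL] at this
  exact this

variable [BorelSpace X]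

theorem continuous_integrable_of_compl_null {μ : Measure X} [IsFiniteMeasure μ] {K : Set X}
    (hK : IsCompact K) (hμ : μ Kᶜ = 0) {f : X → ℝ} (hf : Continuous f) : Integrable f μ := by
  have h : Integrable f (μ.restrict K) := hf.continuousOn.integrableOn_compact hK
  rwa [Measure.restrict_eq_self_of_ae_mem (mem_ae_iff.2 hμ)] at h

theorem Pc.integrable {μ : Measure X} (hμ : Pc μ) {f : X → ℝ} (hf : Continuous f) :
    Integrable f μ := by
  obtain ⟨_, K, hK, hKμ⟩ := hμ
  exact continuous_integrable_of_compl_null hK hKμ hf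

theorem abs_integral_sub_le_of_compl_null {μ : Measure X} [IsProbabilityMeasure μ] {K : Set X}
    (hK : IsCompact K) (hμ : μ Kᶜ = 0) {f g : X → ℝ} (hf : Continuous f) (hg : Continuous g)
    {c : ℝ} (hfg : ∀ x ∈ K, |f x - g x| ≤ c) : |∫ x, f x ∂μ - ∫ x, g x ∂μ| ≤ c := by
  rw [← integral_sub (continuous_integrable_of_compl_null hK hμ hf)
    (continuous_integrable_of_compl_null hK hμ hg)]
  have h := norm_integral_le_of_norm_le_const (μ := μ) (f := fun x => f x - g x) (C := c)
    (Filter.Eventually.mono (mem_ae_iff.2 hμ) hfg)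
  simpa using h

theorem Pc.bddAbove_W1 {μ ν : Measure X} (hμ : Pc μ) (hν : Pc ν) :
    BddAbove (Set.range fun f : {f : X → ℝ // LipschitzWith 1 f} =>
      (∫ x, f.1 x ∂μ) - ∫ x, f.1 x ∂ν) := by
  obtain ⟨_, K, hK, hKμ⟩ := hμ
  obtain ⟨_, L, hL, hLν⟩ := hν
  obtain ⟨x₀⟩ : Nonempty X := nonempty_of_isProbabilityMeasure μ
  obtain ⟨r, hr⟩ := (hK.union hL).isBounded.subset_closedBall x₀
  refine ⟨r + r, ?_⟩
  rintro _ ⟨⟨f, hf⟩, rfl⟩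
  have key : ∀ x ∈ K ∪ L, |f x - f x₀| ≤ r := fun x hx => by
    rw [← Real.dist_eq]
    exact (hf.dist_le_mul x x₀).trans (by simpa using hr hx)
  have h1 := abs_integral_sub_le_of_compl_null hK hKμ hf.continuous
    (continuous_const (y := f x₀)) fun x hx => key x (Or.inl hx)
  have h2 := abs_integral_sub_le_of_compl_null hL hLν hf.continuous
    (continuous_const (y := f x₀)) fun x hx => key x (Or.inr hx)
  simp only [integral_const, probReal_univ, one_smul] at h1 h2
  rw [abs_le] at h1 h2
  dsimp only
  linarith [h1.2, h2.1]

theorem abs_integral_sub_le_W1 {μ ν : Measure X} (hμ : Pc μ) (hν : Pc ν) {f : X → ℝ}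
    (hf : LipschitzWith 1 f) : |∫ x, f x ∂μ - ∫ x, f x ∂ν| ≤ W1 μ ν := by
  have h1 := le_ciSup (hμ.bddAbove_W1 hν) ⟨f, hf⟩
  have h2 := le_ciSup (hμ.bddAbove_W1 hν) ⟨fun x => - f x, hf.neg⟩
  simp only [integral_neg] at h1 h2
  rw [abs_le]
  constructor <;> unfold W1 <;> linarith

end Wasserstein

section Compactness

open BoundedContinuousFunction

theorem isCompact_lipschitzWith_bounded (Y : Type*) [MetricSpace Y] [CompactSpace Y] (L : ℝ≥0)
    (B : ℝ) : IsCompact {f : Y →ᵇ ℝ | LipschitzWith L f ∧ ∀ y, |f y| ≤ B} := by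
  refine BoundedContinuousFunction.arzela_ascoli₂ (Icc (-B) B) isCompact_Icc _ ?_ ?_ ?_
  · have h : {f : Y →ᵇ ℝ | LipschitzWith L f ∧ ∀ y, |f y| ≤ B} =
        (⋂ x, ⋂ y, {f : Y →ᵇ ℝ | dist (f x) (f y) ≤ L * dist x y}) ∩
          ⋂ y, {f : Y →ᵇ ℝ | |f y| ≤ B} := by
      ext f
      simp [lipschitzWith_iff_dist_le_mul]
    rw [h]
    refine IsClosed.inter (isClosed_iInter fun x => isClosed_iInter fun y => ?_)
      (isClosed_iInter fun y => ?_)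
    · exact isClosed_le ((continuous_eval_const x).dist (continuous_eval_const y)) continuous_const
    · exact isClosed_le (continuous_eval_const y).abs continuous_const
  · intro f x hf
    exact abs_le.1 (hf.2 x)
  · refine (LipschitzWith.uniformEquicontinuous _ L fun f => f.2.1).equicontinuous

variable {X : Type*} [MetricSpace X] [MeasurableSpace X] [BorelSpace X]

theorem exists_uniform_limit_of_lipschitz_curves {K : Set X} (hK : IsCompact K) {x₀ : X}
    (hx₀ : x₀ ∈ K) {T M : ℝ} (hM : 0 ≤ M) (m : ℕ → ℝ → Measure X)
    (hm : ∀ n, ∀ t ∈ Icc 0 T, IsProbabilityMeasure (m n t) ∧ m n t Kᶜ = 0)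
    (hlip : ∀ n, ∀ s ∈ Icc 0 T, ∀ t ∈ Icc 0 T, ∀ f : X → ℝ, LipschitzWith 1 f →
      |∫ x, f x ∂(m n t) - ∫ x, f x ∂(m n s)| ≤ M * |t - s|) :
    ∃ φ : ℕ → ℕ, StrictMono φ ∧ ∃ μ : ℝ → Measure X,
      (∀ t ∈ Icc 0 T, IsProbabilityMeasure (μ t) ∧ μ t Kᶜ = 0) ∧
      ∀ ε > 0, ∃ k₀ : ℕ, ∀ k ≥ k₀, ∀ t ∈ Icc 0 T, ∀ f : X → ℝ, LipschitzWith 1 f →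
        |∫ x, f x ∂(m (φ k) t) - ∫ x, f x ∂(μ t)| ≤ ε := by
  have : CompactSpace K := isCompact_iff_compactSpace.1 hK
  obtain ⟨B, hB⟩ := hK.isBounded.subset_closedBall x₀
  set A : Set (K →ᵇ ℝ) := {f | LipschitzWith 1 f ∧ ∀ y, |f y| ≤ B} with hA
  have : CompactSpace A := isCompact_iff_compactSpace.1 (isCompact_lipschitzWith_bounded K 1 B)
  have hext : ∀ f : A, ∃ g : X → ℝ, LipschitzWith 1 g ∧ (∀ x : K, g x = f.1 x) ∧
      ∀ x, g x ∈ Icc (-B) B := by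
    rintro ⟨f, hf, hfB⟩
    have h : LipschitzOnWith 1 (fun x => if h : x ∈ K then f ⟨x, h⟩ else 0) K := by
      rw [lipschitzOnWith_iff_dist_le_mul]
      intro x hx y hy
      simp only [hx, hy, dif_pos]
      exact hf.dist_le_mul ⟨x, hx⟩ ⟨y, hy⟩
    obtain ⟨g, hg, hgf⟩ := h.extend_real
    have hB0 : -B ≤ B := by
      have : 0 ≤ B := by simpa using hB hx₀
      linarith
    refine ⟨fun x => max (-B) (min (g x) B), (hg.min_const B).const_max (-B), fun x => ?_,
      fun x => ⟨le_max_left _ _, max_le hB0 (min_le_right _ _)⟩⟩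
    have hx : g x = f x := by simpa using (hgf x.2).symm
    have := abs_le.1 (hfB x)
    dsimp only
    rw [hx, min_eq_left this.2, max_eq_right this.1]
  choose ext hextL hextK hextB using hext
  have hclose : ∀ n, ∀ t ∈ Icc 0 T, ∀ f g : A,
      |∫ x, ext f x ∂(m n t) - ∫ x, ext g x ∂(m n t)| ≤ dist f g := by
    intro n t ht f g
    have := (hm n t ht).1
    refine abs_integral_sub_le_of_compl_null hK (hm n t ht).2 (hextL f).continuous
      (hextL g).continuous fun x hx => ?_
    rw [hextK f ⟨x, hx⟩, hextK g ⟨x, hx⟩]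
    exact BoundedContinuousFunction.dist_coe_le_dist (f := f.1) (g := g.1) ⟨x, hx⟩
  let G : ℕ → (Icc (0 : ℝ) T × A) → ℝ := fun n p => ∫ x, ext p.2 x ∂(m n p.1)
  have hGL : ∀ n, LipschitzWith (⟨M, hM⟩ + 1) (G n) := by
    intro n
    refine LipschitzWith.of_dist_le_mul fun p q => ?_
    have h1 := hlip n q.1 q.1.2 p.1 p.1.2 (ext p.2) (hextL p.2)
    have h2 := hclose n q.1 q.1.2 p.2 q.2
    have h3 : dist p.1 q.1 ≤ dist p q := le_max_left _ _
    have h4 : dist p.2 q.2 ≤ dist p q := le_max_right _ _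
    have h5 : |(p.1 : ℝ) - q.1| = dist p.1 q.1 := rfl
    rw [h5] at h1
    have h6 := dist_triangle (G n p) (∫ x, ext p.2 x ∂(m n q.1)) (G n q)
    rw [← Real.dist_eq] at h1 h2
    have h7 := mul_le_mul_of_nonneg_left h3 hM
    change _ ≤ (M + 1) * _
    dsimp only [G] at h6 ⊢
    linarith
  have hGB : ∀ n p, |G n p| ≤ B := by
    rintro n ⟨⟨t, ht⟩, f⟩
    have := (hm n t ht).1
    have := abs_integral_sub_le_of_compl_null hK (hm n t ht).2 (hextL f).continuous
      (continuous_const (y := (0 : ℝ))) (c := B) fun x hx => by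
        rw [hextK f ⟨x, hx⟩, sub_zero]
        exact f.2.2 _
    simpa using this
  let G' : ℕ → (Icc (0 : ℝ) T × A) →ᵇ ℝ := fun n =>
    BoundedContinuousFunction.mkOfCompact ⟨G n, (hGL n).continuous⟩
  obtain ⟨g, -, φ, hφ, hlim⟩ :=
    (isCompact_lipschitzWith_bounded (Icc (0 : ℝ) T × A) (⟨M, hM⟩ + 1) B).tendsto_subseq
      (x := G') fun n => ⟨hGL n, hGB n⟩
  have hlim' := (BoundedContinuousFunction.tendsto_iff_tendstoUniformly).1 hlim
  have hμ : ∀ t, ∃ μ : Measure X, t ∈ Icc 0 T → (IsProbabilityMeasure μ ∧ μ Kᶜ = 0) ∧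
      ∀ (ht : t ∈ Icc 0 T) (f : A), ∫ x, ext f x ∂μ = g (⟨t, ht⟩, f) := by
    intro t
    by_cases ht : t ∈ Icc 0 T
    swap
    · exact ⟨0, fun h => absurd h ht⟩
    have hcpt : IsCompact {μ : ProbabilityMeasure X | ∀ _ : ℕ, μ Kᶜ ≤ (0 : ℝ≥0)} :=
      isCompact_setOfPred_probabilityMeasure_mass_eq_compl_isCompact_le (u := fun _ => 0)
        tendsto_const_nhds (fun _ => hK) (Or.inr monotone_const)
    let P : ℕ → ProbabilityMeasure X := fun k => ⟨m (φ k) t, (hm _ t ht).1⟩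
    have hP : ∀ k, P k ∈ {μ : ProbabilityMeasure X | ∀ _ : ℕ, μ Kᶜ ≤ (0 : ℝ≥0)} := by
      intro k _
      have := (hm (φ k) t ht).2
      simp [P, this]
    obtain ⟨μ, hμK, hμ⟩ := hcpt.exists_mapClusterPt (f := (atTop : Filter ℕ)) (u := P) (by
      rw [Filter.le_principal_iff]
      exact Filter.mem_map.2 (Filter.Eventually.of_forall hP))
    have hμ0 : (μ : Measure X) Kᶜ = 0 := by
      have := hμK 0
      simpa using this
    refine ⟨μ, fun _ => ⟨⟨inferInstance, hμ0⟩, fun _ f => ?_⟩⟩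
    obtain ⟨U, hU, hUμ⟩ := mapClusterPt_iff_ultrafilter.1 hμ
    have h1 := (ProbabilityMeasure.tendsto_iff_forall_integral_tendsto.1 hUμ)
      (BoundedContinuousFunction.ofNormedAddCommGroup (ext f) (hextL f).continuous B
        fun x => abs_le.2 (hextB f x))
    have h2 := (hlim'.tendsto_at (⟨t, ht⟩, f)).mono_left hU
    exact tendsto_nhds_unique h1 h2
  choose μ hμ using hμ
  refine ⟨φ, hφ, μ, fun t ht => (hμ t ht).1, fun ε hε => ?_⟩
  rw [Metric.tendstoUniformly_iff] at hlim'
  obtain ⟨k₀, hk₀⟩ := eventually_atTop.1 (hlim' ε hε)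
  refine ⟨k₀, fun k hk t ht f hf => ?_⟩
  let f₁ : A := ⟨BoundedContinuousFunction.mkOfCompact
    ⟨fun x : K => f x - f x₀, by have := hf.continuous; fun_prop⟩, by
      refine ⟨LipschitzWith.of_dist_le_mul fun x y => ?_, fun x => ?_⟩
      · change dist (f x - f x₀) (f y - f x₀) ≤ _
        rw [dist_sub_right]
        exact hf.dist_le_mul x y
      · change |f x - f x₀| ≤ B
        rw [← Real.dist_eq]
        exact (hf.dist_le_mul x x₀).trans (by simpa using hB x.2)⟩
  have hf₁ : ∀ ν : Measure X, IsProbabilityMeasure ν ∧ ν Kᶜ = 0 →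
      ∫ x, ext f₁ x ∂ν = ∫ x, f x ∂ν - f x₀ := by
    rintro ν ⟨_, hν⟩
    have h1 : ∫ x, ext f₁ x ∂ν = ∫ x, (f x - f x₀) ∂ν := by
      refine integral_congr_ae (Filter.Eventually.mono (mem_ae_iff.2 hν) fun x hx => ?_)
      exact hextK f₁ ⟨x, hx⟩
    rw [h1, integral_sub (continuous_integrable_of_compl_null hK hν hf.continuous)
      (integrable_const _)]
    simp
  have h := hk₀ k hk (⟨t, ht⟩, f₁)
  have h' : dist (g (⟨t, ht⟩, f₁)) (∫ x, ext f₁ x ∂(m (φ k) t)) < ε := h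
  rw [← (hμ t ht).2 ht f₁, hf₁ _ (hμ t ht).1, hf₁ _ (hm _ t ht), dist_comm, Real.dist_eq,
    sub_sub_sub_cancel_right] at h'
  exact h'.le

end Compactness
section Fibers

theorem ae_mem_msupp {X : Type*} [TopologicalSpace X] [HereditarilyLindelofSpace X]
    [MeasurableSpace X] (μ : Measure X) : ∀ᵐ x ∂μ, x ∈ msupp μ := by
  filter_upwards [Measure.support_mem_ae (μ := μ)] with x hx U hU hxU
  exact (Measure.mem_support_iff_forall x).1 hx U (hU.mem_nhds hxU)

theorem msupp_subset_of_isClosed {X : Type*} [TopologicalSpace X] [MeasurableSpace X]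
    {μ : Measure X} {K : Set X} (hK : IsClosed K) (hμ : μ Kᶜ = 0) : msupp μ ⊆ K := by
  intro x hx
  by_contra h
  exact (hx Kᶜ hK.isOpen_compl h).ne' hμ

variable {d : ℕ}

/-- `μ` is a probability measure concentrated on the closed ball of radius `R` around `0`. -/
def ProbInBall (R : ℝ) (μ : Measure (Euc d)) : Prop :=
  IsProbabilityMeasure μ ∧ μ (closedBall 0 R)ᶜ = 0

theorem ProbInBall.pc {R : ℝ} {μ : Measure (Euc d)} (h : ProbInBall R μ) : Pc μ :=
  ⟨h.1, _, isCompact_closedBall 0 R, h.2⟩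

theorem ProbInBall.ae_norm_le {R : ℝ} {μ : Measure (Euc d)} (h : ProbInBall R μ) :
    ∀ᵐ x ∂μ, ‖x‖ ≤ R := by
  filter_upwards [mem_ae_iff.2 h.2] with x hx
  simpa using hx

theorem ProbInBall.mono {R S : ℝ} {μ : Measure (Euc d)} (h : ProbInBall R μ) (hRS : R ≤ S) :
    ProbInBall S μ :=
  ⟨h.1, measure_mono_null (compl_subset_compl.2 (closedBall_subset_closedBall hRS)) h.2⟩

theorem Pc.exists_probInBall {μ : Measure (Euc d)} (h : Pc μ) :
    ∃ R, 0 ≤ R ∧ ProbInBall R μ := by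
  obtain ⟨hp, K, hK, hμ⟩ := h
  obtain ⟨r, hr⟩ := hK.isBounded.subset_closedBall 0
  exact ⟨max r 0, le_max_right _ _, hp, measure_mono_null (compl_subset_compl.2
    (hr.trans (closedBall_subset_closedBall (le_max_left _ _)))) hμ⟩

theorem H1cond.ae_norm_snd_le {C R : ℝ} (hC : 0 ≤ C) (hR : 0 ≤ R)
    {V : Measure (Euc d) → Measure (Euc d × Euc d)} (h1 : H1cond C V) {μ : Measure (Euc d)}
    (hμ : ProbInBall R μ) : ∀ᵐ p ∂(V μ), ‖p.2‖ ≤ C * (1 + R) := by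
  filter_upwards [ae_mem_msupp (V μ)] with p hp
  refine (h1 μ hμ.pc p hp).trans ?_
  gcongr
  refine Real.iSup_le (fun x => ?_) hR
  simpa using msupp_subset_of_isClosed isClosed_closedBall hμ.2 x.2

theorem bary_eq (m : Measure (Euc d × Euc d)) [IsFiniteMeasure m] (x : Euc d) :
    bary m x = ∫ v, v ∂(m.condKernel x) := by
  unfold bary disint
  rw [dif_pos ‹_›]

theorem measurable_bary (m : Measure (Euc d × Euc d)) [IsFiniteMeasure m] :
    Measurable (bary m) := by
  have h : StronglyMeasurable fun x => ∫ v, (fun p : Euc d × Euc d => p.2) (x, v)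
      ∂(m.condKernel x) :=
    measurable_snd.stronglyMeasurable.integral_kernel_prod_right'
  exact (funext (bary_eq m)) ▸ h.measurable

theorem ae_norm_bary_le (m : Measure (Euc d × Euc d)) [IsFiniteMeasure m] {M : ℝ}
    (hm : ∀ᵐ p ∂m, ‖p.2‖ ≤ M) : ∀ᵐ x ∂(m.map Prod.fst), ‖bary m x‖ ≤ M := by
  have h : ∀ᵐ p ∂(m.fst.compProd m.condKernel), ‖p.2‖ ≤ M := by
    rwa [m.disintegrate m.condKernel]
  filter_upwards [Measure.ae_ae_of_ae_compProd h] with x hx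
  rw [bary_eq]
  simpa using norm_integral_le_of_norm_le_const hx

theorem integral_apply_bary {m : Measure (Euc d × Euc d)} (hm : Pc m)
    {L : Euc d → Euc d →L[ℝ] ℝ} (hL : Continuous L) :
    ∫ x, L x (bary m x) ∂(m.map Prod.fst) = ∫ p, L p.1 p.2 ∂m := by
  have := hm.1
  have h1 : Integrable (fun p : Euc d × Euc d => L p.1 p.2) m :=
    hm.integrable (by fun_prop)
  have h2 : Integrable (fun p : Euc d × Euc d => p.2) m :=
    (integrable_norm_iff (by fun_prop)).1 (hm.integrable (by fun_prop))
  rw [← Measure.integral_condKernel h1]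
  refine integral_congr_ae ?_
  filter_upwards [h2.condKernel_ae] with x hx
  rw [bary_eq, ← ContinuousLinearMap.integral_comp_comm _ hx]

end Fibers

section Step

variable {d : ℕ}

theorem probInBall_map_add_smul {R M τ : ℝ} (hτ : 0 ≤ τ) {μ : Measure (Euc d)}
    (hμ : ProbInBall R μ) {b : Euc d → Euc d} (hb : Measurable b) (hbM : ∀ᵐ x ∂μ, ‖b x‖ ≤ M) :
    ProbInBall (R + τ * M) (μ.map fun x => x + τ • b x) := by
  have hmeas : Measurable fun x => x + τ • b x := measurable_id.add (hb.const_smul τ)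
  have := hμ.1
  refine ⟨Measure.isProbabilityMeasure_map hmeas.aemeasurable, ?_⟩
  rw [← mem_ae_iff]
  refine (ae_map_iff hmeas.aemeasurable measurableSet_closedBall).2 ?_
  filter_upwards [hμ.ae_norm_le, hbM] with x hx hbx
  rw [dist_zero_right]
  calc ‖x + τ • b x‖ ≤ ‖x‖ + τ * ‖b x‖ := by
        simpa [norm_smul, abs_of_nonneg hτ] using norm_add_le x (τ • b x)
    _ ≤ R + τ * M := by gcongr

theorem abs_integral_map_add_smul_sub_le {R M s t : ℝ} (hs : 0 ≤ s) (ht : 0 ≤ t)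
    {μ : Measure (Euc d)} (hμ : ProbInBall R μ) {b : Euc d → Euc d} (hb : Measurable b)
    (hbM : ∀ᵐ x ∂μ, ‖b x‖ ≤ M) {f : Euc d → ℝ} (hf : LipschitzWith 1 f) :
    |∫ x, f x ∂(μ.map fun x => x + t • b x) - ∫ x, f x ∂(μ.map fun x => x + s • b x)|
      ≤ M * |t - s| := by
  have hmeas : ∀ τ : ℝ, Measurable fun x => x + τ • b x :=
    fun τ => measurable_id.add (hb.const_smul τ)
  have := hμ.1
  have hH_int : ∀ τ : ℝ, 0 ≤ τ → Integrable (fun x => f (x + τ • b x)) μ := fun τ hτ =>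
    (integrable_map_measure hf.continuous.aestronglyMeasurable (hmeas τ).aemeasurable).1
      ((probInBall_map_add_smul hτ hμ hb hbM).pc.integrable hf.continuous)
  rw [integral_map (hmeas t).aemeasurable hf.continuous.aestronglyMeasurable,
    integral_map (hmeas s).aemeasurable hf.continuous.aestronglyMeasurable,
    ← integral_sub (hH_int t ht) (hH_int s hs), ← Real.norm_eq_abs]
  refine (norm_integral_le_of_norm_le_const (C := M * |t - s|) ?_).trans_eq (by simp)
  filter_upwards [hbM] with x hx
  have h := hf.dist_le_mul (x + t • b x) (x + s • b x)
  rw [dist_add_left, dist_eq_norm, dist_eq_norm, ← sub_smul, norm_smul, NNReal.coe_one, one_mul,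
    Real.norm_eq_abs (t - s), mul_comm] at h
  exact h.trans (by gcongr)

theorem abs_sub_sub_smul_fderiv_le {f : Euc d → ℝ} (hf : Differentiable ℝ f) {L : ℝ≥0}
    (hL : LipschitzWith L (fderiv ℝ f)) {M h s t : ℝ} (hs : s ∈ Icc 0 h) (ht : t ∈ Icc 0 h)
    (x : Euc d) {b : Euc d} (hb : ‖b‖ ≤ M) :
    |f (x + t • b) - f (x + s • b) - (t - s) * fderiv ℝ f x b| ≤ L * M ^ 2 * h * |t - s| := by
  have hM : 0 ≤ M := (norm_nonneg b).trans hb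
  have hh : 0 ≤ h := hs.1.trans hs.2
  have hmem : ∀ τ ∈ Icc 0 h, x + τ • b ∈ closedBall x (h * M) := by
    intro τ hτ
    rw [mem_closedBall, dist_self_add_left, norm_smul, Real.norm_eq_abs, abs_of_nonneg hτ.1]
    gcongr
    exact hτ.2
  have key := (convex_closedBall x (h * M)).norm_image_sub_le_of_norm_fderiv_le'
    (f := f) (φ := fderiv ℝ f x) (C := L * (h * M)) (fun y _ => hf y) (fun y hy => by
      rw [← dist_eq_norm]
      refine (hL.dist_le_mul y x).trans ?_
      gcongr
      exact hy) (hmem s hs) (hmem t ht)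
  have e : x + t • b - (x + s • b) = (t - s) • b := by rw [sub_smul]; abel
  rw [e, map_smul, smul_eq_mul, norm_smul, Real.norm_eq_abs, Real.norm_eq_abs] at key
  refine key.trans ?_
  calc L * (h * M) * (|t - s| * ‖b‖) ≤ L * (h * M) * (|t - s| * M) := by gcongr
    _ = _ := by ring

theorem abs_integral_map_sub_sub_fderiv_le {R M h s t : ℝ} (hs : s ∈ Icc 0 h) (ht : t ∈ Icc 0 h)
    {μ : Measure (Euc d)} (hμ : ProbInBall R μ) {b : Euc d → Euc d} (hb : Measurable b)
    (hbM : ∀ᵐ x ∂μ, ‖b x‖ ≤ M) {f : Euc d → ℝ} (hf : Differentiable ℝ f) {L : ℝ≥0}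
    (hL : LipschitzWith L (fderiv ℝ f)) {D : ℝ} (hD : ∀ x, ‖fderiv ℝ f x‖ ≤ D) :
    |∫ x, f x ∂(μ.map fun x => x + t • b x) - ∫ x, f x ∂(μ.map fun x => x + s • b x)
      - (t - s) * ∫ x, fderiv ℝ f x (b x) ∂μ| ≤ L * M ^ 2 * h * |t - s| := by
  have hmeas : ∀ τ : ℝ, Measurable fun x => x + τ • b x :=
    fun τ => measurable_id.add (hb.const_smul τ)
  have := hμ.1
  have hH_int : ∀ τ : ℝ, 0 ≤ τ → Integrable (fun x => f (x + τ • b x)) μ := fun τ hτ =>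
    (integrable_map_measure hf.continuous.aestronglyMeasurable (hmeas τ).aemeasurable).1
      ((probInBall_map_add_smul hτ hμ hb hbM).pc.integrable hf.continuous)
  have hH_int' : Integrable (fun x => fderiv ℝ f x (b x)) μ := by
    refine Integrable.of_bound (C := D * M) ?_ ?_
    · have hm : Measurable (fderiv ℝ f) := hL.continuous.measurable
      have hc : Continuous fun q : (Euc d →L[ℝ] ℝ) × Euc d => q.1 q.2 := by fun_prop
      exact (hc.measurable.comp (hm.prodMk hb)).aestronglyMeasurable
    · filter_upwards [hbM] with x hx
      have hM : 0 ≤ D := (norm_nonneg _).trans (hD x)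
      exact ((fderiv ℝ f x).le_opNorm _).trans (by gcongr; exact hD x)
  rw [integral_map (hmeas t).aemeasurable hf.continuous.aestronglyMeasurable,
    integral_map (hmeas s).aemeasurable hf.continuous.aestronglyMeasurable,
    ← integral_sub (hH_int t ht.1) (hH_int s hs.1), ← integral_const_mul,
    ← integral_sub (f := fun x => f (x + t • b x) - f (x + s • b x))
      ((hH_int t ht.1).sub (hH_int s hs.1)) (hH_int'.const_mul _), ← Real.norm_eq_abs]
  refine (norm_integral_le_of_norm_le_const (C := L * M ^ 2 * h * |t - s|) ?_).trans_eq (by simp)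
  filter_upwards [hbM] with x hx
  exact abs_sub_sub_smul_fderiv_le hf hL hs ht x hx

end Step

section Grid

theorem rel_of_rel_on_grid {h : ℝ} {Q : ℝ → ℝ → Prop}
    (htrans : ∀ r s t, r ≤ s → s ≤ t → Q r s → Q s t → Q r t) (N : ℕ)
    (hQ : ∀ j ≤ N, ∀ s t, (j : ℝ) * h ≤ s → s ≤ t → t ≤ ((j : ℝ) + 1) * h → Q s t) :
    ∀ s t, 0 ≤ s → s ≤ t → t ≤ ((N : ℝ) + 1) * h → Q s t := by
  induction N with
  | zero => exact fun s t hs hst ht => hQ 0 le_rfl s t (by simpa using hs) hst (by simpa using ht)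
  | succ N ih =>
    intro s t hs hst ht
    have ih' := ih fun j hj => hQ j (hj.trans N.le_succ)
    have hN := hQ (N + 1) le_rfl
    push_cast at hN ht
    rcases le_total t (((N : ℝ) + 1) * h) with h1 | h1
    · exact ih' s t hs hst h1
    rcases le_total s (((N : ℝ) + 1) * h) with h2 | h2
    · exact htrans s _ t h2 h1 (ih' s _ hs h2 le_rfl) (hN _ t le_rfl h1 ht)
    · exact hN s t h2 hst ht

/-- The index `j` of the cell `(jh, (j+1)h]` that contains `s`, for `s > 0`. -/
def gridIdx (h s : ℝ) : ℕ := ⌈s / h⌉.toNat - 1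

theorem gridIdx_eq {h s : ℝ} (hh : 0 < h) {j : ℕ} (h1 : (j : ℝ) * h < s)
    (h2 : s ≤ ((j : ℝ) + 1) * h) : gridIdx h s = j := by
  have hc : ⌈s / h⌉ = (j : ℤ) + 1 := by
    rw [Int.ceil_eq_iff]
    push_cast
    rw [add_sub_cancel_right, lt_div_iff₀ hh, div_le_iff₀ hh]
    exact ⟨h1, h2⟩
  unfold gridIdx
  omega

theorem gridIdx_spec {h s : ℝ} (hh : 0 < h) (hs : 0 < s) :
    (gridIdx h s : ℝ) * h < s ∧ s ≤ ((gridIdx h s : ℝ) + 1) * h := by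
  have hpos : 0 < ⌈s / h⌉ := Int.ceil_pos.2 (div_pos hs hh)
  have hz : ((gridIdx h s : ℕ) : ℤ) = ⌈s / h⌉ - 1 := by
    unfold gridIdx
    omega
  have hr : (gridIdx h s : ℝ) = (⌈s / h⌉ : ℝ) - 1 := by
    exact_mod_cast congrArg (Int.cast : ℤ → ℝ) hz
  rw [hr, sub_add_cancel, ← lt_div_iff₀ hh, ← div_le_iff₀ hh]
  exact ⟨by linarith [Int.ceil_lt_add_one (s / h)], Int.le_ceil _⟩

theorem gridIdx_lt {h s : ℝ} (hh : 0 < h) {N : ℕ} (hs : 0 < s) (hsN : s ≤ N * h) :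
    gridIdx h s < N := by
  have h1 : (gridIdx h s : ℝ) * h < N * h := (gridIdx_spec hh hs).1.trans_le hsN
  exact_mod_cast lt_of_mul_lt_mul_right h1 hh.le

theorem measurable_gridIdx (h : ℝ) : Measurable (gridIdx h) := by
  have h1 : Measurable fun z : ℤ => z.toNat - 1 := Measurable.of_discrete
  have h2 : Measurable fun s : ℝ => s / h := measurable_id.div_const h
  exact h1.comp (Int.measurable_ceil.comp h2)

theorem abs_sub_sub_integral_gridIdx_le {g : ℝ → ℝ} {a : ℕ → ℝ} {h c : ℝ} (hh : 0 < h) (N : ℕ)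
    (hg : ∀ j ≤ N, ∀ s t, (j : ℝ) * h ≤ s → s ≤ t → t ≤ ((j : ℝ) + 1) * h →
      |g t - g s - (t - s) * a j| ≤ c * (t - s)) {t : ℝ} (ht : 0 ≤ t)
    (htN : t ≤ ((N : ℝ) + 1) * h) :
    |g t - g 0 - ∫ s in 0..t, a (gridIdx h s)| ≤ c * t := by
  have key := rel_of_rel_on_grid (h := h)
    (Q := fun s t => IntervalIntegrable (fun u => a (gridIdx h u)) volume s t ∧
      |g t - g s - ∫ u in s..t, a (gridIdx h u)| ≤ c * (t - s)) ?_ N ?_ 0 t le_rfl ht htN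
  · simpa using key.2
  · rintro r s t - - ⟨hi, h1⟩ ⟨hi', h2⟩
    refine ⟨hi.trans hi', ?_⟩
    rw [← intervalIntegral.integral_add_adjacent_intervals hi hi']
    rw [abs_le] at *
    constructor <;> linarith [h1.1, h1.2, h2.1, h2.2]
  · intro j hj s t hs hst ht
    have heq : ∀ u ∈ uIoc s t, a j = a (gridIdx h u) := by
      intro u hu
      rw [uIoc_of_le hst] at hu
      rw [gridIdx_eq hh (hs.trans_lt hu.1) (hu.2.trans ht)]
    have hi : IntervalIntegrable (fun _ => a j) volume s t := intervalIntegrable_const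
    refine ⟨hi.congr heq, ?_⟩
    rw [← intervalIntegral.integral_congr_ae (Filter.Eventually.of_forall heq)]
    simpa using hg j hj s t hs hst ht

end Grid

section Scheme

variable {d : ℕ} {V : Measure (Euc d) → Measure (Euc d × Euc d)}

theorem mvelT_zero (T : ℝ) (N : ℕ) (V : Measure (Euc d) → Measure (Euc d × Euc d))
    (μ₀ : Measure (Euc d)) : mvelT T N V μ₀ 0 = μ₀ :=
  if_pos le_rfl

theorem mvelT_eq_map {T : ℝ} (hT : 0 < T) {N : ℕ} (hN : 0 < N) (μ₀ : Measure (Euc d)) (j : ℕ)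
    {t : ℝ} (h1 : (j : ℝ) * (T / N) ≤ t) (h2 : t ≤ ((j : ℝ) + 1) * (T / N)) :
    mvelT T N V μ₀ t = (mvelStep T N V μ₀ j).map fun x =>
      x + (t - (j : ℝ) * (T / N)) • bary (V (mvelStep T N V μ₀ j)) x := by
  have hh : 0 < T / N := by positivity
  have hdef : ∀ t : ℝ, 0 < t → mvelT T N V μ₀ t =
      (mvelStep T N V μ₀ (gridIdx (T / N) t)).map fun x =>
        x + (t - (gridIdx (T / N) t : ℝ) * (T / N)) •
          bary (V (mvelStep T N V μ₀ (gridIdx (T / N) t))) x := fun t ht =>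
    if_neg ht.not_ge
  rcases h1.lt_or_eq with h | rfl
  · have ht : 0 < t := lt_of_le_of_lt (by positivity) h
    rw [hdef t ht, gridIdx_eq hh h h2]
  · cases j with
    | zero => simp [mvelT_zero, mvelStep]
    | succ i =>
      have hi : gridIdx (T / N) (((i + 1 : ℕ) : ℝ) * (T / N)) = i := by
        refine gridIdx_eq hh ?_ ?_ <;> push_cast <;> nlinarith
      have hτ : ((i + 1 : ℕ) : ℝ) * (T / N) - (i : ℝ) * (T / N) = T / N := by
        push_cast
        ring
      rw [hdef _ (by positivity), hi, hτ, sub_self]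
      simp [mvelStep]

theorem mvelT_grid {T : ℝ} (hT : 0 < T) {N : ℕ} (hN : 0 < N) (μ₀ : Measure (Euc d)) (j : ℕ) :
    mvelT T N V μ₀ ((j : ℝ) * (T / N)) = mvelStep T N V μ₀ j := by
  have hh : 0 < T / N := by positivity
  rw [mvelT_eq_map hT hN μ₀ j le_rfl (by nlinarith)]
  simp

theorem ProbInBall.measurable_bary {R : ℝ} (hV : IsPVF V) {μ : Measure (Euc d)}
    (hμ : ProbInBall R μ) : Measurable (bary (V μ)) := by
  have := (hV μ hμ.1).1
  exact _root_.measurable_bary _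

theorem ProbInBall.ae_norm_bary_le {C R : ℝ} (hV : IsPVF V) (hC : 0 ≤ C) (h1 : H1cond C V)
    (hR : 0 ≤ R) {μ : Measure (Euc d)} (hμ : ProbInBall R μ) :
    ∀ᵐ x ∂μ, ‖bary (V μ) x‖ ≤ C * (1 + R) := by
  have := (hV μ hμ.1).1
  have h := _root_.ae_norm_bary_le (V μ) (h1.ae_norm_snd_le hC hR hμ)
  rwa [(hV μ hμ.1).2] at h

theorem probInBall_mvelStep {C R₀ T : ℝ} (hT : 0 < T) (hV : IsPVF V) (hC : 0 ≤ C)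
    (h1 : H1cond C V) (hR₀ : 0 ≤ R₀) {μ₀ : Measure (Euc d)} (hμ₀ : ProbInBall R₀ μ₀) {N : ℕ}
    {j : ℕ} (hj : j ≤ N) :
    ProbInBall (Real.exp (C * T) * (1 + R₀) - 1) (mvelStep T N V μ₀ j) := by
  set h : ℝ := T / N with hh
  have hh0 : 0 ≤ h := by positivity
  have hpow : ∀ j : ℕ, 1 ≤ (h * C + 1) ^ j := fun j => one_le_pow₀ (by nlinarith)
  have key : ∀ j : ℕ, ProbInBall ((h * C + 1) ^ j * (1 + R₀) - 1) (mvelStep T N V μ₀ j) := by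
    intro j
    induction j with
    | zero => simpa [mvelStep] using hμ₀
    | succ j ih =>
      have hR : 0 ≤ (h * C + 1) ^ j * (1 + R₀) - 1 := by nlinarith [hpow j]
      refine (probInBall_map_add_smul hh0 ih (ih.measurable_bary hV)
        (ih.ae_norm_bary_le hV hC h1 hR)).mono (le_of_eq ?_)
      ring
  refine (key j).mono ?_
  gcongr
  calc (h * C + 1) ^ j ≤ Real.exp (h * C) ^ j := by
        gcongr
        exact Real.add_one_le_exp _
    _ = Real.exp (j * (h * C)) := (Real.exp_nat_mul _ _).symm
    _ ≤ Real.exp (C * T) := by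
        refine Real.exp_le_exp.2 ?_
        rcases N.eq_zero_or_pos with rfl | hN
        · have : h = 0 := by simp [hh]
          rw [this, zero_mul, mul_zero]
          positivity
        · have hNh : (N : ℝ) * h = T := by rw [hh]; field_simp
          calc (j : ℝ) * (h * C) ≤ N * (h * C) := by gcongr
            _ = C * T := by rw [← mul_assoc, hNh, mul_comm]

theorem H2.exists_integral_close (h2 : H2 V) (hV : IsPVF V) {C R : ℝ} (hC : 0 ≤ C) (hR : 0 ≤ R)
    (h1 : H1cond C V) {G : Euc d × Euc d → ℝ} (hG : ContDiff ℝ 1 G) {μ : Measure (Euc d)}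
    (hμ : ProbInBall R μ) {ε : ℝ} (hε : 0 < ε) :
    ∃ δ > 0, ∀ ν, ProbInBall R ν → W1 μ ν < δ → |∫ p, G p ∂(V μ) - ∫ p, G p ∂(V ν)| < ε := by
  set K : Set (Euc d × Euc d) := closedBall 0 R ×ˢ closedBall 0 (C * (1 + R)) with hK
  obtain ⟨L, hL⟩ := hG.contDiffOn.exists_lipschitzOnWith (s := K) one_ne_zero
    ((convex_closedBall _ _).prod (convex_closedBall _ _))
    ((isCompact_closedBall _ _).prod (isCompact_closedBall _ _))
  obtain ⟨g, hg, hGg⟩ := hL.extend_real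
  have hH_int : ∀ ν, ProbInBall R ν → ∫ p, G p ∂(V ν) = ∫ p, g p ∂(V ν) := by
    intro ν hν
    have hfst : ∀ᵐ p ∂(V ν), ‖p.1‖ ≤ R := by
      have h := hν.ae_norm_le
      rw [← (hV ν hν.1).2] at h
      exact ae_of_ae_map measurable_fst.aemeasurable h
    refine integral_congr_ae ?_
    filter_upwards [hfst, h1.ae_norm_snd_le hC hR hν] with p hp1 hp2
    exact hGg ⟨by simpa using hp1, by simpa using hp2⟩
  obtain ⟨δ, hδ, h⟩ := h2.2 μ hμ.pc (ε / (L + 1)) (by positivity)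
  refine ⟨δ, hδ, fun ν hν hW => ?_⟩
  rw [hH_int μ hμ, hH_int ν hν]
  refine (abs_integral_sub_le_mul (fun f hf =>
    abs_integral_sub_le_W1 (h2.1 μ hμ.pc) (h2.1 ν hν.pc) hf) hg).trans_lt ?_
  rw [← lt_div_iff₀' (by positivity)]
  exact h ν hν.pc hW

theorem abs_integral_fderiv_le (hV : IsPVF V) {C R D : ℝ} (hC : 0 ≤ C) (hR : 0 ≤ R)
    (h1 : H1cond C V) {f : Euc d → ℝ} (hD : ∀ x, ‖fderiv ℝ f x‖ ≤ D) {μ : Measure (Euc d)}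
    (hμ : ProbInBall R μ) :
    |∫ p : Euc d × Euc d, fderiv ℝ f p.1 p.2 ∂(V μ)| ≤ D * (C * (1 + R)) := by
  have := (hV μ hμ.1).1
  have h : ∀ᵐ p ∂(V μ), ‖fderiv ℝ f p.1 p.2‖ ≤ D * (C * (1 + R)) := by
    filter_upwards [h1.ae_norm_snd_le hC hR hμ] with p hp
    have hD0 : 0 ≤ D := (norm_nonneg _).trans (hD p.1)
    exact ((fderiv ℝ f p.1).le_opNorm _).trans (by gcongr; exact hD _)
  simpa using norm_integral_le_of_norm_le_const h

end Scheme

section Convergence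

variable {d : ℕ} {V : Measure (Euc d) → Measure (Euc d × Euc d)}

theorem exists_grid_cell {T : ℝ} (hT : 0 < T) {N : ℕ} (hN : 0 < N) {t : ℝ} (ht : t ∈ Icc 0 T) :
    ∃ j < N, (j : ℝ) * (T / N) ≤ t ∧ t ≤ ((j : ℝ) + 1) * (T / N) := by
  have hh : 0 < T / N := by positivity
  have hNT : (N : ℝ) * (T / N) = T := by field_simp
  rcases ht.1.eq_or_lt with rfl | h
  · exact ⟨0, hN, by simp, by simpa using hh.le⟩
  · exact ⟨gridIdx (T / N) t, gridIdx_lt hh h (hNT.symm ▸ ht.2), (gridIdx_spec hh h).1.le,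
      (gridIdx_spec hh h).2⟩

theorem probInBall_mvelT {C R T : ℝ} (hT : 0 < T) (hV : IsPVF V) (hC : 0 ≤ C)
    (h1 : H1cond C V) (hR : 0 ≤ R) {μ₀ : Measure (Euc d)} {N : ℕ} (hN : 0 < N)
    (hstep : ∀ j ≤ N, ProbInBall R (mvelStep T N V μ₀ j)) {t : ℝ} (ht : t ∈ Icc 0 T) :
    ProbInBall (R + T * (C * (1 + R))) (mvelT T N V μ₀ t) := by
  obtain ⟨j, hj, hjt, htj⟩ := exists_grid_cell hT hN ht
  have hμ := hstep j hj.le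
  rw [mvelT_eq_map hT hN μ₀ j hjt htj]
  refine (probInBall_map_add_smul (sub_nonneg.2 hjt) hμ (hμ.measurable_bary hV)
    (hμ.ae_norm_bary_le hV hC h1 hR)).mono ?_
  have hj0 : 0 ≤ (j : ℝ) * (T / N) := by positivity
  gcongr
  linarith [ht.2]

theorem abs_integral_mvelT_sub_le {C R T : ℝ} (hT : 0 < T) (hV : IsPVF V) (hC : 0 ≤ C)
    (h1 : H1cond C V) (hR : 0 ≤ R) {μ₀ : Measure (Euc d)} (n : ℕ)
    (hstep : ∀ j ≤ n + 1, ProbInBall R (mvelStep T (n + 1) V μ₀ j)) {f : Euc d → ℝ}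
    (hf : LipschitzWith 1 f) {s t : ℝ} (hs : s ∈ Icc 0 T) (ht : t ∈ Icc 0 T) :
    |∫ x, f x ∂(mvelT T (n + 1) V μ₀ t) - ∫ x, f x ∂(mvelT T (n + 1) V μ₀ s)|
      ≤ C * (1 + R) * |t - s| := by
  wlog hst : s ≤ t generalizing s t
  · rw [abs_sub_comm, abs_sub_comm t]
    exact this ht hs (le_of_not_ge hst)
  rw [abs_of_nonneg (sub_nonneg.2 hst)]
  refine rel_of_rel_on_grid (h := T / (n + 1 : ℕ))
    (Q := fun s t => |∫ x, f x ∂(mvelT T (n + 1) V μ₀ t) - ∫ x, f x ∂(mvelT T (n + 1) V μ₀ s)|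
      ≤ C * (1 + R) * (t - s)) ?_ n ?_ s t hs.1 hst ?_
  · intro r s t _ _ h h'
    rw [abs_le] at *
    constructor <;> linarith [h.1, h.2, h'.1, h'.2]
  · intro j hj s t hjs hst htj
    have hμ := hstep j (hj.trans n.le_succ)
    rw [mvelT_eq_map hT n.succ_pos μ₀ j (hjs.trans hst) htj,
      mvelT_eq_map hT n.succ_pos μ₀ j hjs (hst.trans htj)]
    have h := abs_integral_map_add_smul_sub_le (sub_nonneg.2 hjs)
      (sub_nonneg.2 (hjs.trans hst)) hμ (hμ.measurable_bary hV)
      (hμ.ae_norm_bary_le hV hC h1 hR) hf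
    rwa [sub_sub_sub_cancel_right, abs_of_nonneg (sub_nonneg.2 hst)] at h
  · refine ht.2.trans (le_of_eq ?_)
    push_cast
    field_simp

theorem abs_integral_mvelT_sub_sub_integral_le {C R T : ℝ} (hT : 0 < T) (hV : IsPVF V)
    (h2 : H2 V) (hC : 0 ≤ C) (h1 : H1cond C V) (hR : 0 ≤ R) {μ₀ : Measure (Euc d)} (n : ℕ)
    (hstep : ∀ j ≤ n + 1, ProbInBall R (mvelStep T (n + 1) V μ₀ j)) {f : Euc d → ℝ}
    (hf : Differentiable ℝ f) {L : ℝ≥0} (hL : LipschitzWith L (fderiv ℝ f)) {D : ℝ}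
    (hD : ∀ x, ‖fderiv ℝ f x‖ ≤ D) {t : ℝ} (ht : t ∈ Icc 0 T) :
    |∫ x, f x ∂(mvelT T (n + 1) V μ₀ t) - ∫ x, f x ∂(mvelT T (n + 1) V μ₀ 0) -
      ∫ s in 0..t, ∫ p : Euc d × Euc d, fderiv ℝ f p.1 p.2
        ∂(V (mvelStep T (n + 1) V μ₀ (gridIdx (T / (n + 1 : ℕ)) s)))|
      ≤ L * (C * (1 + R)) ^ 2 * (T / (n + 1 : ℕ)) * t := by
  have hh : 0 < T / (n + 1 : ℕ) := by positivity
  refine abs_sub_sub_integral_gridIdx_le (g := fun t => ∫ x, f x ∂(mvelT T (n + 1) V μ₀ t))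
    (a := fun j => ∫ p : Euc d × Euc d, fderiv ℝ f p.1 p.2 ∂(V (mvelStep T (n + 1) V μ₀ j)))
    hh n ?_ ht.1 ?_
  · intro j hj s t hjs hst htj
    have hμ := hstep j (hj.trans n.le_succ)
    rw [mvelT_eq_map hT n.succ_pos μ₀ j (hjs.trans hst) htj,
      mvelT_eq_map hT n.succ_pos μ₀ j hjs (hst.trans htj)]
    have h := abs_integral_map_sub_sub_fderiv_le (h := T / (n + 1 : ℕ))
      (s := s - j * (T / (n + 1 : ℕ))) (t := t - j * (T / (n + 1 : ℕ)))
      ⟨by linarith, by linarith⟩ ⟨by linarith, by linarith⟩ hμ (hμ.measurable_bary hV)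
      (hμ.ae_norm_bary_le hV hC h1 hR) hf hL hD
    have hb := integral_apply_bary (h2.1 _ hμ.pc) hL.continuous
    rw [(hV _ hμ.1).2] at hb
    rwa [sub_sub_sub_cancel_right, abs_of_nonneg (sub_nonneg.2 hst), hb] at h
  · refine ht.2.trans (le_of_eq ?_)
    push_cast
    field_simp

theorem isMDESol_of_uniform_limit {C R T : ℝ} (hT : 0 < T) (hV : IsPVF V) (h2 : H2 V)
    (hC : 0 ≤ C) (h1 : H1cond C V) (hR : 0 ≤ R) {μ₀ : Measure (Euc d)} {φ : ℕ → ℕ}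
    (hφ : StrictMono φ)
    (hstep : ∀ n, ∀ j ≤ n + 1, ProbInBall R (mvelStep T (n + 1) V μ₀ j))
    {μ : ℝ → Measure (Euc d)} (hμ : ∀ t ∈ Icc 0 T, ProbInBall (R + T * (C * (1 + R))) (μ t))
    (hlim : ∀ ε > 0, ∃ k₀ : ℕ, ∀ k ≥ k₀, ∀ t ∈ Icc 0 T, ∀ f : Euc d → ℝ, LipschitzWith 1 f →
      |∫ x, f x ∂(mvelT T (φ k + 1) V μ₀ t) - ∫ x, f x ∂(μ t)| ≤ ε) :
    IsMDESol T V μ := by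
  intro f hf hfs
  set M : ℝ := C * (1 + R) with hM
  have hM0 : 0 ≤ M := by positivity
  have hR' : 0 ≤ R + T * M := by positivity
  have hf2 : ContDiff ℝ 1 (fderiv ℝ f) := hf.fderiv_right (by norm_cast)
  have hf1 : Differentiable ℝ f := hf.differentiable (by simp)
  obtain ⟨L, hL⟩ := hf2.lipschitzWith_of_hasCompactSupport (hfs.fderiv ℝ) one_ne_zero
  obtain ⟨L', hL'⟩ := hf.lipschitzWith_of_hasCompactSupport hfs (by simp)
  obtain ⟨D, hD⟩ := (hfs.fderiv ℝ).exists_bound_of_continuous hf2.continuous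
  have hG : ContDiff ℝ 1 fun p : Euc d × Euc d => fderiv ℝ f p.1 p.2 :=
    (hf2.comp contDiff_fst).clm_apply contDiff_snd
  set F : Measure (Euc d) → ℝ :=
    fun m => ∫ p : Euc d × Euc d, fderiv ℝ f p.1 p.2 ∂(V m) with hF
  let h : ℕ → ℝ := fun k => T / (φ k + 1 : ℕ)
  have hh : ∀ k, 0 < h k := fun k => by positivity
  have hh0 : Tendsto h atTop (𝓝 0) := by
    refine Tendsto.div_atTop tendsto_const_nhds ?_
    exact tendsto_natCast_atTop_atTop.comp
      ((tendsto_add_atTop_nat 1).comp hφ.tendsto_atTop)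
  have hhT : ∀ k, ((φ k + 1 : ℕ) : ℝ) * h k = T := fun k => by
    simp only [h]
    field_simp
  let H : ℕ → ℝ → ℝ := fun k s => F (mvelStep T (φ k + 1) V μ₀ (gridIdx (h k) s))
  have hstep' : ∀ k, ∀ s ∈ Ioc 0 T,
      ProbInBall (R + T * M) (mvelStep T (φ k + 1) V μ₀ (gridIdx (h k) s)) := fun k s hs =>
    (hstep _ _ (gridIdx_lt (hh k) hs.1 ((hhT k).symm ▸ hs.2)).le).mono
      (le_add_of_nonneg_right (by positivity))
  have hHmeas : ∀ k, Measurable (H k) := fun k =>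
    (measurable_from_top (f := fun j => F (mvelStep T (φ k + 1) V μ₀ j))).comp
      (measurable_gridIdx (h k))
  have hHbound : ∀ k, ∀ s ∈ Ioc 0 T, ‖H k s‖ ≤ D * (C * (1 + (R + T * M))) := fun k s hs =>
    abs_integral_fderiv_le hV hC hR' h1 hD (hstep' k s hs)
  have hHlim : ∀ s ∈ Ioc 0 T, Tendsto (fun k => H k s) atTop (𝓝 (F (μ s))) := by
    intro s hs
    rw [Metric.tendsto_atTop]
    intro ε hε
    have hsT : s ∈ Icc 0 T := Ioc_subset_Icc_self hs
    obtain ⟨δ, hδ, hclose⟩ := h2.exists_integral_close hV hC hR' h1 hG (hμ s hsT) hε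
    obtain ⟨k₁, hk₁⟩ := hlim (δ / 3) (by positivity)
    have hMh : Tendsto (fun k => M * h k) atTop (𝓝 0) := by simpa using hh0.const_mul M
    obtain ⟨k₂, hk₂⟩ := eventually_atTop.1 (hMh.eventually_lt_const (by positivity : 0 < δ / 3))
    refine ⟨max k₁ k₂, fun k hk => ?_⟩
    rw [dist_comm]
    refine hclose _ (hstep' k s hs) (lt_of_le_of_lt (b := δ / 3 + δ / 3)
      (W1_le fun g hg => ?_) (by linarith))
    have hspec := gridIdx_spec (hh k) hs.1
    have h3 := hk₁ k (le_of_max_le_left hk) s hsT g hg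
    have h4 := abs_integral_mvelT_sub_le hT hV hC h1 hR (φ k) (hstep (φ k)) hg
      (s := gridIdx (h k) s * h k) (t := s)
      ⟨mul_nonneg (Nat.cast_nonneg _) (hh k).le, hspec.1.le.trans hs.2⟩ hsT
    rw [mvelT_grid hT (φ k).succ_pos] at h4
    have h5 : |s - gridIdx (h k) s * h k| ≤ h k := by
      rw [abs_le]
      constructor <;> linarith [hspec.1, hspec.2, hh k]
    have h6 := mul_le_mul_of_nonneg_left h5 hM0
    have h7 := hk₂ k (le_of_max_le_right hk)
    rw [abs_le] at *
    constructor <;> linarith [h3.1, h3.2, h4.1, h4.2]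
  have hHae : ∀ k, ∀ t ≤ T, ∀ᵐ s ∂(volume.restrict (Ioc 0 t)),
      ‖H k s‖ ≤ D * (C * (1 + (R + T * M))) := fun k t ht =>
    (ae_restrict_iff' measurableSet_Ioc).2
      (Filter.Eventually.of_forall fun s hs => hHbound k s ⟨hs.1, hs.2.trans ht⟩)
  have hHlimae : ∀ t ≤ T, ∀ᵐ s ∂(volume.restrict (Ioc 0 t)),
      Tendsto (fun k => H k s) atTop (𝓝 (F (μ s))) := fun t ht =>
    (ae_restrict_iff' measurableSet_Ioc).2
      (Filter.Eventually.of_forall fun s hs => hHlim s ⟨hs.1, hs.2.trans ht⟩)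
  refine ⟨?_, fun t ht => ?_⟩
  · rw [integrableOn_Icc_iff_integrableOn_Ioc]
    refine Integrable.of_bound (C := D * (C * (1 + (R + T * M))))
      (aestronglyMeasurable_of_tendsto_ae atTop
        (fun k => (hHmeas k).aestronglyMeasurable) (hHlimae T le_rfl)) ?_
    refine (ae_restrict_iff' measurableSet_Ioc).2 (Filter.Eventually.of_forall fun s hs => ?_)
    exact abs_integral_fderiv_le hV hC hR' h1 hD (hμ s (Ioc_subset_Icc_self hs))
  · have hF1 : ∀ r ∈ Icc 0 T, Tendsto (fun k => ∫ x, f x ∂(mvelT T (φ k + 1) V μ₀ r)) atTop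
        (𝓝 (∫ x, f x ∂(μ r))) := by
      intro r hr
      rw [Metric.tendsto_atTop]
      intro ε hε
      obtain ⟨k₀, hk₀⟩ := hlim (ε / 2 / (L' + 1)) (by positivity)
      refine ⟨k₀, fun k hk => ?_⟩
      have := abs_integral_sub_le_mul (fun g hg => hk₀ k hk r hr g hg) hL'
      rw [mul_div_cancel₀ _ (by positivity : (L' : ℝ) + 1 ≠ 0)] at this
      exact this.trans_lt (half_lt_self hε)
    have hH_int : Tendsto (fun k => ∫ s in 0..t, H k s) atTop (𝓝 (∫ s in Icc 0 t, F (μ s))) := by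
      simp_rw [intervalIntegral.integral_of_le ht.1, integral_Icc_eq_integral_Ioc]
      exact tendsto_integral_of_dominated_convergence (fun _ => D * (C * (1 + (R + T * M))))
        (fun k => (hHmeas k).aestronglyMeasurable) (integrable_const _)
        (fun k => hHae k t ht.2) (hHlimae t ht.2)
    have hzero : Tendsto (fun k => L * M ^ 2 * h k * t) atTop (𝓝 0) := by
      simpa using (hh0.const_mul (L * M ^ 2 : ℝ)).mul_const t
    have hdiff : Tendsto (fun k => ∫ x, f x ∂(mvelT T (φ k + 1) V μ₀ t) -
        ∫ x, f x ∂(mvelT T (φ k + 1) V μ₀ 0) - ∫ s in 0..t, H k s) atTop (𝓝 0) :=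
      squeeze_zero_norm (fun k => abs_integral_mvelT_sub_sub_integral_le hT hV h2 hC h1 hR (φ k)
        (hstep (φ k)) hf1 hL hD ht) hzero
    have huniq := tendsto_nhds_unique hdiff
      (((hF1 t ht).sub (hF1 0 ⟨le_rfl, hT.le⟩)).sub hH_int)
    linarith

end Convergence

/-- Theorem `thm:convMV`: under (H1) and (H2), the mean velocity scheme
converges, up to a subsequence, uniformly in time for the Wasserstein distance, to a
solution of the MDE with initial datum `μ₀`. -/
theorem mean_velocity_scheme_converges {d : ℕ} (T : ℝ) (hT : 0 < T)
    (V : Measure (Euc d) → Measure (Euc d × Euc d)) (hV : IsPVF V)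
    (h1 : H1 V) (h2 : H2 V)
    (μ₀ : Measure (Euc d)) (hμ₀ : Pc μ₀) :
    ∃ φ : ℕ → ℕ, StrictMono φ ∧ ∃ μ : ℝ → Measure (Euc d),
      μ 0 = μ₀ ∧ (∀ t ∈ Icc (0 : ℝ) T, Pc (μ t)) ∧ IsMDESol T V μ ∧
      ∀ ε > 0, ∃ K : ℕ, ∀ k ≥ K, ∀ t ∈ Icc (0 : ℝ) T,
        W1 (mvelT T (φ k) V μ₀ t) (μ t) < ε := by
  obtain ⟨C, hC, h1⟩ := h1
  obtain ⟨R₀, hR₀, hμR⟩ := hμ₀.exists_probInBall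
  set R : ℝ := Real.exp (C * T) * (1 + R₀) - 1 with hRdef
  have hR : 0 ≤ R := by
    have : 1 ≤ Real.exp (C * T) := Real.one_le_exp (by positivity)
    nlinarith
  have hstep : ∀ n, ∀ j ≤ n + 1, ProbInBall R (mvelStep T (n + 1) V μ₀ j) := fun n j hj =>
    probInBall_mvelStep hT hV hC.le h1 hR₀ hμR hj
  have hcurve : ∀ n, ∀ t ∈ Icc 0 T,
      ProbInBall (R + T * (C * (1 + R))) (mvelT T (n + 1) V μ₀ t) := fun n t ht =>
    probInBall_mvelT hT hV hC.le h1 hR n.succ_pos (hstep n) ht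
  obtain ⟨φ, hφ, ν, hν, hlim⟩ := exists_uniform_limit_of_lipschitz_curves
    (isCompact_closedBall (0 : Euc d) (R + T * (C * (1 + R))))
    (mem_closedBall_self (by positivity)) (T := T) (M := C * (1 + R)) (by positivity)
    (fun n t => mvelT T (n + 1) V μ₀ t) hcurve
    fun n s hs t ht f hf => abs_integral_mvelT_sub_le hT hV hC.le h1 hR n (hstep n) hf hs ht
  let μ : ℝ → Measure (Euc d) := fun t => if t ≤ 0 then μ₀ else ν t
  have hμ0 : μ 0 = μ₀ := if_pos le_rfl
  have hμpos : ∀ t, 0 < t → μ t = ν t := fun t ht => if_neg ht.not_ge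
  have hμ : ∀ t ∈ Icc 0 T, ProbInBall (R + T * (C * (1 + R))) (μ t) := by
    intro t ht
    rcases ht.1.eq_or_lt with rfl | h
    · rw [hμ0, ← mvelT_zero T (0 + 1) V μ₀]
      exact hcurve 0 0 ht
    · rw [hμpos t h]
      exact hν t ht
  have hlim' : ∀ ε > 0, ∃ k₀ : ℕ, ∀ k ≥ k₀, ∀ t ∈ Icc 0 T, ∀ f : Euc d → ℝ,
      LipschitzWith 1 f → |∫ x, f x ∂(mvelT T (φ k + 1) V μ₀ t) - ∫ x, f x ∂(μ t)| ≤ ε := by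
    intro ε hε
    obtain ⟨k₀, hk₀⟩ := hlim ε hε
    refine ⟨k₀, fun k hk t ht f hf => ?_⟩
    rcases ht.1.eq_or_lt with rfl | h
    · rw [hμ0, mvelT_zero, sub_self, abs_zero]
      exact hε.le
    · rw [hμpos t h]
      exact hk₀ k hk t ht f hf
  refine ⟨fun k => φ k + 1, fun a b hab => Nat.succ_lt_succ (hφ hab), μ, hμ0,
    fun t ht => (hμ t ht).pc, isMDESol_of_uniform_limit hT hV h2 hC.le h1 hR hφ hstep hμ hlim',
    fun ε hε => ?_⟩
  obtain ⟨k₀, hk₀⟩ := hlim' (ε / 2) (half_pos hε)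
  exact ⟨k₀, fun k hk t ht => (W1_le (hk₀ k hk t ht)).trans_lt (half_lt_self hε)⟩

end
end

section
/- For any V₁, V₂ ∈ 𝒫_c(Tℝ^d) with marginals μ_i = π₁♯V_i, one has W^{Tℝ^d}(V₁, V₂) ≤ 𝒲(V₁, V₂) + W^{ℝ^d}(μ₁, μ₂), where W^{Tℝ^d} denotes the 1-Wasserstein distance on 𝒫_c(ℝ^d × ℝ^d) for the Euclidean norm and W^{ℝ^d} the 1-Wasserstein distance on 𝒫_c(ℝ^d). -/
open MeasureTheory Set Filter Topology Metric
open scoped ENNReal NNReal Classical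

noncomputable section

/-- 1-Wasserstein distance on `𝒫(Tℝ^d)` over transference plans, for the Euclidean norm on
`Tℝ^d = ℝ^d × ℝ^d ≅ ℝ^{2d}`. -/
def WprodEuc {d : ℕ} (V₁ V₂ : Measure (Euc d × Euc d)) : ℝ :=
  sInf ((fun π : Measure ((Euc d × Euc d) × (Euc d × Euc d)) =>
      ∫ q, Real.sqrt (‖q.1.1 - q.2.1‖ ^ 2 + ‖q.1.2 - q.2.2‖ ^ 2) ∂π) '' Couplings V₁ V₂)

open ProbabilityTheory

namespace Couplings

variable {X Y : Type*} [MeasurableSpace X] [MeasurableSpace Y]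
  {μ : Measure X} {ν : Measure Y} {π : Measure (X × Y)}

lemma isProbabilityMeasure (hπ : π ∈ Couplings μ ν) [IsProbabilityMeasure μ] :
    IsProbabilityMeasure π := by
  have : IsProbabilityMeasure (π.map Prod.fst) := by rw [hπ.1]; infer_instance
  exact Measure.isProbabilityMeasure_of_map Prod.fst

lemma measure_compl_prod_eq_zero (hπ : π ∈ Couplings μ ν) {K : Set X} {L : Set Y}
    (hK : MeasurableSet K) (hL : MeasurableSet L) (hμ : μ Kᶜ = 0) (hν : ν Lᶜ = 0) :
    π (K ×ˢ L)ᶜ = 0 := by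
  have h₁ : π (Prod.fst ⁻¹' Kᶜ) = 0 := by
    rw [← Measure.map_apply measurable_fst hK.compl, hπ.1, hμ]
  have h₂ : π (Prod.snd ⁻¹' Lᶜ) = 0 := by
    rw [← Measure.map_apply measurable_snd hL.compl, hπ.2, hν]
  refine measure_mono_null (fun p hp => ?_) (measure_union_null h₁ h₂)
  simp only [mem_compl_iff, mem_prod, not_and_or] at hp
  exact hp

end Couplings

lemma Continuous.integrable_of_measure_compl_isCompact_eq_zero {X : Type*} [TopologicalSpace X]
    [T2Space X] [MeasurableSpace X] [OpensMeasurableSpace X] {π : Measure X} [IsFiniteMeasure π]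
    {K : Set X} (hK : IsCompact K) (hπ : π Kᶜ = 0) {f : X → ℝ} (hf : Continuous f) :
    Integrable f π := by
  have h : IntegrableOn f K π := by
    obtain ⟨C, hC⟩ := hK.exists_bound_of_continuousOn hf.continuousOn
    exact IntegrableOn.of_bound (measure_lt_top π K)
      hf.measurable.aestronglyMeasurable C
      ((ae_restrict_iff' hK.measurableSet).2 (Eventually.of_forall hC))
  rwa [IntegrableOn, Measure.restrict_eq_self_of_ae_mem (s := K) (by rwa [ae_iff])] at h

/-- Optimal transference plans exist between compactly supported probability measures. -/
lemma OptCouplings.nonempty {X : Type*} [MetricSpace X] [SecondCountableTopology X]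
    [MeasurableSpace X] [BorelSpace X] {μ ν : Measure X}
    [IsProbabilityMeasure μ] [IsProbabilityMeasure ν] {K L : Set X}
    (hK : IsCompact K) (hL : IsCompact L) (hμ : μ Kᶜ = 0) (hν : ν Lᶜ = 0) :
    (OptCouplings μ ν).Nonempty := by
  have hKL : IsCompact (K ×ˢ L) := hK.prod hL
  have hnull {π : Measure (X × X)} (hπ : π ∈ Couplings μ ν) : π (K ×ˢ L)ᶜ = 0 :=
    Couplings.measure_compl_prod_eq_zero hπ hK.measurableSet hL.measurableSet hμ hν
  let S : Set (ProbabilityMeasure (X × X)) := {π | (π : Measure (X × X)) ∈ Couplings μ ν}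
  have hS_closed : IsClosed S := by
    let μ' : ProbabilityMeasure X := ⟨μ, inferInstance⟩
    let ν' : ProbabilityMeasure X := ⟨ν, inferInstance⟩
    have hS : S = {π | π.map measurable_fst.aemeasurable = μ'} ∩
        {π | π.map measurable_snd.aemeasurable = ν'} := by
      ext π
      exact and_congr
        (Subtype.ext_iff (a1 := π.map measurable_fst.aemeasurable) (a2 := μ')).symm
        (Subtype.ext_iff (a1 := π.map measurable_snd.aemeasurable) (a2 := ν')).symm
    rw [hS]
    exact (isClosed_eq (ProbabilityMeasure.continuous_map continuous_fst) continuous_const).inter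
      (isClosed_eq (ProbabilityMeasure.continuous_map continuous_snd) continuous_const)
  have hS_compact : IsCompact S := by
    rw [← hS_closed.closure_eq]
    refine isCompact_closure_of_isTightMeasureSet
      (isTightMeasureSet_iff_exists_isCompact_measure_compl_le.2 fun ε _ => ⟨K ×ˢ L, hKL, ?_⟩)
    rintro _ ⟨π, hπ, rfl⟩
    rw [hnull hπ]
    exact zero_le
  have hS_nonempty : S.Nonempty :=
    ⟨⟨μ.prod ν, inferInstance⟩, by
      constructor
      · simp [Measure.map_fst_prod]
      · simp [Measure.map_snd_prod]⟩
  obtain ⟨C, hC⟩ := hKL.exists_bound_of_continuousOn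
    (continuous_dist (α := X)).continuousOn
  let c : BoundedContinuousFunction (X × X) ℝ :=
    BoundedContinuousFunction.ofNormedAddCommGroup (fun p => min (dist p.1 p.2) |C|)
      (by fun_prop) |C| (fun p => by
        rw [Real.norm_of_nonneg (le_min dist_nonneg (abs_nonneg C))]
        exact min_le_right _ _)
  have hc {π : Measure (X × X)} (hπ : π ∈ Couplings μ ν) :
      ∫ p, c p ∂π = ∫ p, dist p.1 p.2 ∂π := by
    refine integral_congr_ae ?_
    have hmem : ∀ᵐ p ∂π, p ∈ K ×ˢ L := hnull hπ
    filter_upwards [hmem] with p hp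
    exact min_eq_left (((le_abs_self _).trans (hC p hp)).trans (le_abs_self C))
  obtain ⟨π, hπ, hmin⟩ := hS_compact.exists_isMinOn hS_nonempty
    (ProbabilityMeasure.continuous_integral_boundedContinuousFunction c).continuousOn
  suffices h : IsLeast ((fun ρ : Measure (X × X) => ∫ p, dist p.1 p.2 ∂ρ) '' Couplings μ ν)
      (∫ p, dist p.1 p.2 ∂(π : Measure (X × X))) from ⟨π, hπ, h.csInf_eq.symm⟩
  refine ⟨⟨π, hπ, rfl⟩, ?_⟩
  rintro _ ⟨ρ, hρ, rfl⟩
  have hρ' : IsProbabilityMeasure ρ := Couplings.isProbabilityMeasure hρ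
  have hle : ∫ p, c p ∂(π : Measure (X × X)) ≤ ∫ p, c p ∂ρ :=
    hmin (show (⟨ρ, hρ'⟩ : ProbabilityMeasure (X × X)) ∈ S from hρ)
  rwa [hc hπ, hc hρ] at hle

lemma MeasureTheory.Measure.map_compProd_comap {α β γ : Type*} [MeasurableSpace α]
    [MeasurableSpace β] [MeasurableSpace γ] (π : Measure α) [SFinite π]
    (κ : Kernel β γ) [IsSFiniteKernel κ] {f : α → β} (hf : Measurable f) :
    (π ⊗ₘ κ.comap f hf).map (Prod.map f id) = π.map f ⊗ₘ κ := by
  have hfi : Measurable (Prod.map f (id : γ → γ)) := hf.prodMap measurable_id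
  ext s hs
  rw [Measure.map_apply hfi hs, Measure.compProd_apply (hfi hs), Measure.compProd_apply hs,
    lintegral_map (Kernel.measurable_kernel_prodMk_left hs) hf]
  rfl

/-- **Gluing**: a transference plan between the first marginals of two probability measures on
products lifts to a transference plan between the measures themselves. -/
lemma Couplings.exists_map_fst_eq {X Y X' Y' : Type*} [MeasurableSpace X] [MeasurableSpace Y]
    [MeasurableSpace X'] [MeasurableSpace Y'] [StandardBorelSpace Y] [Nonempty Y]
    [StandardBorelSpace Y'] [Nonempty Y'] {V : Measure (X × Y)} {V' : Measure (X' × Y')}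
    [IsProbabilityMeasure V] [IsProbabilityMeasure V'] {π : Measure (X × X')}
    (hπ : π ∈ Couplings (V.map Prod.fst) (V'.map Prod.fst)) :
    ∃ P ∈ Couplings V V', P.map (fun q => (q.1.1, q.2.1)) = π := by
  have : IsProbabilityMeasure (V.map Prod.fst) :=
    Measure.isProbabilityMeasure_map measurable_fst.aemeasurable
  have : IsProbabilityMeasure π := Couplings.isProbabilityMeasure hπ
  let κ : Kernel (X × X') Y := V.condKernel.comap Prod.fst measurable_fst
  let κ' : Kernel (X × X') Y' := V'.condKernel.comap Prod.snd measurable_snd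
  let Q : Measure ((X × X') × (Y × Y')) := π ⊗ₘ (κ ×ₖ κ')
  have hfst : Q.map (Prod.map id Prod.fst) = π ⊗ₘ κ := by
    rw [← Measure.compProd_map measurable_fst, ← Kernel.fst_eq, Kernel.fst_prod]
  have hsnd : Q.map (Prod.map id Prod.snd) = π ⊗ₘ κ' := by
    rw [← Measure.compProd_map measurable_snd, ← Kernel.snd_eq, Kernel.snd_prod]
  let r : (X × X') × (Y × Y') → (X × Y) × (X' × Y') :=
    fun q => ((q.1.1, q.2.1), (q.1.2, q.2.2))
  have hr : Measurable r := by fun_prop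
  refine ⟨Q.map r, ⟨?_, ?_⟩, ?_⟩
  · rw [Measure.map_map measurable_fst hr]
    calc Q.map (Prod.fst ∘ r)
        = (Q.map (Prod.map id Prod.fst)).map (Prod.map Prod.fst id) := by
          rw [Measure.map_map (by fun_prop) (by fun_prop)]; rfl
      _ = V := by
          rw [hfst, Measure.map_compProd_comap, hπ.1]
          exact V.disintegrate V.condKernel
  · rw [Measure.map_map measurable_snd hr]
    calc Q.map (Prod.snd ∘ r)
        = (Q.map (Prod.map id Prod.snd)).map (Prod.map Prod.snd id) := by
          rw [Measure.map_map (by fun_prop) (by fun_prop)]; rfl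
      _ = V' := by
          rw [hsnd, Measure.map_compProd_comap, hπ.2]
          exact V'.disintegrate V'.condKernel
  · rw [Measure.map_map (by fun_prop) hr]
    exact Measure.fst_compProd π (κ ×ₖ κ')

lemma measure_map_compl_image_eq_zero {X Y : Type*} [MeasurableSpace X] [MeasurableSpace Y]
    {V : Measure X} {f : X → Y} (hf : Measurable f) {K : Set X} (hV : V Kᶜ = 0)
    (hK : MeasurableSet (f '' K)) : V.map f (f '' K)ᶜ = 0 := by
  rw [Measure.map_apply hf hK.compl]
  exact measure_mono_null (fun x hx hxK => hx (mem_image_of_mem f hxK)) hV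

lemma Real.sqrt_sq_add_sq_le_add {a b : ℝ} (ha : 0 ≤ a) (hb : 0 ≤ b) :
    √(a ^ 2 + b ^ 2) ≤ a + b :=
  Real.sqrt_le_iff.2 ⟨by positivity, by nlinarith [mul_nonneg ha hb]⟩

/-- for any `V₁, V₂ ∈ 𝒫_c(Tℝ^d)` with marginals `μ_i = π₁♯V_i`,
`W^{Tℝ^d}(V₁,V₂) ≤ 𝒲(V₁,V₂) + W^{ℝ^d}(μ₁,μ₂)`. -/
theorem wasserstein_le_Wfib_add_wasserstein {d : ℕ}
    (V₁ V₂ : Measure (Euc d × Euc d))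
    (h₁ : IsProbabilityMeasure V₁) (h₂ : IsProbabilityMeasure V₂)
    (hc₁ : ∃ K : Set (Euc d × Euc d), IsCompact K ∧ V₁ Kᶜ = 0)
    (hc₂ : ∃ K : Set (Euc d × Euc d), IsCompact K ∧ V₂ Kᶜ = 0) :
    WprodEuc V₁ V₂ ≤ Wfib V₁ V₂ + Wplan (V₁.map Prod.fst) (V₂.map Prod.fst) := by
  obtain ⟨K₁, hK₁, hV₁⟩ := hc₁
  obtain ⟨K₂, hK₂, hV₂⟩ := hc₂
  have : IsProbabilityMeasure (V₁.map Prod.fst) :=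
    Measure.isProbabilityMeasure_map measurable_fst.aemeasurable
  have : IsProbabilityMeasure (V₂.map Prod.fst) :=
    Measure.isProbabilityMeasure_map measurable_fst.aemeasurable
  have hL₁ := hK₁.image continuous_fst
  have hL₂ := hK₂.image continuous_fst
  obtain ⟨π, hπ⟩ := OptCouplings.nonempty hL₁ hL₂
    (measure_map_compl_image_eq_zero measurable_fst hV₁ hL₁.measurableSet)
    (measure_map_compl_image_eq_zero measurable_fst hV₂ hL₂.measurableSet)
  obtain ⟨P₀, hP₀, hP₀π⟩ := Couplings.exists_map_fst_eq hπ.1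
  rw [← sub_le_iff_le_add]
  refine le_csInf ⟨_, P₀, ⟨hP₀, by rwa [hP₀π]⟩, rfl⟩ ?_
  rintro _ ⟨P, ⟨hP, hPopt⟩, rfl⟩
  rw [sub_le_iff_le_add]
  have : IsProbabilityMeasure P := Couplings.isProbabilityMeasure hP
  have hint {f : (Euc d × Euc d) × (Euc d × Euc d) → ℝ} (hf : Continuous f) : Integrable f P :=
    hf.integrable_of_measure_compl_isCompact_eq_zero (hK₁.prod hK₂)
      (Couplings.measure_compl_prod_eq_zero hP hK₁.measurableSet hK₂.measurableSet hV₁ hV₂)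
  have hbase : ∫ q, ‖q.1.1 - q.2.1‖ ∂P = Wplan (V₁.map Prod.fst) (V₂.map Prod.fst) := by
    rw [← hPopt.2, integral_map (by fun_prop) continuous_dist.aestronglyMeasurable]
    simp only [dist_eq_norm]
  calc WprodEuc V₁ V₂
      ≤ ∫ q, √(‖q.1.1 - q.2.1‖ ^ 2 + ‖q.1.2 - q.2.2‖ ^ 2) ∂P := by
        refine csInf_le ⟨0, ?_⟩ ⟨P, hP, rfl⟩
        rintro _ ⟨ρ, -, rfl⟩
        exact integral_nonneg fun q => Real.sqrt_nonneg _
    _ ≤ ∫ q, (‖q.1.1 - q.2.1‖ + ‖q.1.2 - q.2.2‖) ∂P :=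
        integral_mono (hint (by fun_prop)) (hint (by fun_prop)) fun q =>
          Real.sqrt_sq_add_sq_le_add (norm_nonneg _) (norm_nonneg _)
    _ = (∫ q, ‖q.1.2 - q.2.2‖ ∂P) + Wplan (V₁.map Prod.fst) (V₂.map Prod.fst) := by
        rw [integral_add (hint (by fun_prop)) (hint (by fun_prop)), hbase, add_comm]

end
end

section
/- Non-uniqueness for the splitting-particle MDE. Let V be the splitting-particle probability vector field on ℝ and fix x₀ ∈ ℝ and T > 0. Then both curves μ¹ and μ² defined by μ¹_t = δ_{x₀} for all t ∈ [0,T] and μ²_t = (1/2)δ_{x₀+t} + (1/2)δ_{x₀−t} for all t ∈ [0,T] are solutions of the MDE μ̇_t = V[μ_t] with initial datum μ₀ = δ_{x₀}. In particular, solutions of this MDE are not unique. -/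
open MeasureTheory Set Filter Topology Metric
open scoped ENNReal NNReal Classical

noncomputable section

/-- Solution of the measure differential equation `μ̇_t = V[μ_t]` on `[0,T]`, in dimension 1. -/
def IsMDESol1 (T : ℝ) (V : Measure ℝ → Measure (ℝ × ℝ)) (μ : ℝ → Measure ℝ) : Prop :=
  ∀ f : ℝ → ℝ, ContDiff ℝ (⊤ : ℕ∞) f → HasCompactSupport f →
    IntegrableOn (fun t => ∫ p : ℝ × ℝ, deriv f p.1 * p.2 ∂(V (μ t))) (Icc 0 T) ∧
    ∀ t ∈ Icc (0 : ℝ) T,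
      (∫ x, f x ∂(μ t)) - (∫ x, f x ∂(μ 0)) =
        ∫ s in Icc (0 : ℝ) t, (∫ p : ℝ × ℝ, deriv f p.1 * p.2 ∂(V (μ s)))

/-- The median-type point `B(μ) = sup{x : μ((-∞,x]) ≤ 1/2}`. -/
def Bsp (μ : Measure ℝ) : ℝ := sSup {x : ℝ | μ (Iic x) ≤ 1 / 2}

/-- `η(μ) = μ((-∞,B(μ)]) - 1/2`. -/
def etaSp (μ : Measure ℝ) : ℝ≥0∞ := μ (Iic (Bsp μ)) - 1 / 2

/-- The fiber measures `ν_x[μ]` of the splitting-particle PVF. -/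
def nuSp (μ : Measure ℝ) (x : ℝ) : Measure ℝ :=
  if x < Bsp μ then Measure.dirac (-1)
  else if Bsp μ < x then Measure.dirac 1
  else (μ {Bsp μ})⁻¹ •
    (etaSp μ • Measure.dirac 1 + (1 / 2 - μ (Iio (Bsp μ))) • Measure.dirac (-1))

/-- The splitting-particle probability vector field `V[μ] = μ ⊗ ν_x[μ]`. -/
def Vsp (μ : Measure ℝ) : Measure (ℝ × ℝ) :=
  μ.bind fun x => (nuSp μ x).map fun v => (x, v)

/-- The splitting solution `μ_t = (1/2) δ_{x₀+t} + (1/2) δ_{x₀-t}`. -/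
def splitSol (x₀ t : ℝ) : Measure ℝ :=
  (1 / 2 : ℝ≥0∞) • Measure.dirac (x₀ + t) + (1 / 2 : ℝ≥0∞) • Measure.dirac (x₀ - t)

theorem splitSol_zero (x₀ : ℝ) : splitSol x₀ 0 = Measure.dirac x₀ := by
  simp only [splitSol, add_zero, sub_zero, ← add_smul, ENNReal.add_halves, one_smul]

theorem splitSol_apply (x₀ t : ℝ) (s : Set ℝ) :
    splitSol x₀ t s = 1 / 2 * s.indicator 1 (x₀ + t) + 1 / 2 * s.indicator 1 (x₀ - t) := by
  simp only [splitSol, Measure.add_apply, Measure.smul_apply, smul_eq_mul, Measure.dirac_apply]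

theorem half_lt_one_ennreal : (1 / 2 : ℝ≥0∞) < 1 := by
  rw [one_div]; exact ENNReal.one_half_lt_one

theorem Bsp_splitSol (x₀ : ℝ) {t : ℝ} (ht : 0 ≤ t) : Bsp (splitSol x₀ t) = x₀ + t := by
  have h : {x : ℝ | splitSol x₀ t (Iic x) ≤ 1 / 2} = Iio (x₀ + t) := by
    ext x
    simp only [mem_ofPred_eq, mem_Iio, splitSol_apply]
    constructor
    · intro hx
      by_contra! h
      have h' : x₀ - t ≤ x := by linarith
      simp only [indicator, mem_Iic, h, h', if_true, Pi.one_apply, mul_one,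
        ENNReal.add_halves] at hx
      exact absurd hx half_lt_one_ennreal.not_ge
    · intro h
      by_cases h' : x₀ - t ≤ x <;>
        simp [indicator, mem_Iic, h.not_ge, h']
  rw [Bsp, h, csSup_Iio]

theorem etaSp_splitSol (x₀ : ℝ) {t : ℝ} (ht : 0 ≤ t) : etaSp (splitSol x₀ t) = 1 / 2 := by
  have h : x₀ - t ≤ x₀ + t := by linarith
  simp only [etaSp, Bsp_splitSol x₀ ht, splitSol_apply, indicator, mem_Iic, le_refl, h, if_true,
    Pi.one_apply, mul_one, ENNReal.add_halves]
  simp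

theorem nuSp_splitSol_right (x₀ : ℝ) {t : ℝ} (ht : 0 < t) :
    nuSp (splitSol x₀ t) (x₀ + t) = Measure.dirac 1 := by
  have h : x₀ - t < x₀ + t := by linarith
  have h₂ : (2⁻¹ : ℝ≥0∞)⁻¹ * 2⁻¹ = 1 := ENNReal.inv_mul_cancel (by simp) (by simp)
  simp only [nuSp, Bsp_splitSol x₀ ht.le, etaSp_splitSol x₀ ht.le, lt_irrefl, if_false,
    splitSol_apply, indicator, mem_Iio, mem_singleton_iff, h, h.ne, if_true]
  simp only [Pi.one_apply, mul_one, mul_zero, add_zero, zero_add, tsub_self, zero_smul, smul_smul,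
    one_div, h₂, one_smul]

theorem nuSp_splitSol_left (x₀ : ℝ) {t : ℝ} (ht : 0 < t) :
    nuSp (splitSol x₀ t) (x₀ - t) = Measure.dirac (-1) := by
  have h : x₀ - t < x₀ + t := by linarith
  simp only [nuSp, Bsp_splitSol x₀ ht.le, h, if_true]

theorem nuSp_splitSol_zero (x₀ : ℝ) :
    nuSp (splitSol x₀ 0) x₀ =
      (1 / 2 : ℝ≥0∞) • Measure.dirac 1 + (1 / 2 : ℝ≥0∞) • Measure.dirac (-1) := by
  have hB : Bsp (splitSol x₀ 0) = x₀ := by simpa using Bsp_splitSol x₀ le_rfl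
  have hη := etaSp_splitSol x₀ le_rfl
  rw [nuSp, hη, hB, splitSol_zero]
  simp

theorem bind_splitSol (x₀ t : ℝ) (κ : ℝ → Measure (ℝ × ℝ)) :
    (splitSol x₀ t).bind κ = (1 / 2 : ℝ≥0∞) • κ (x₀ + t) + (1 / 2 : ℝ≥0∞) • κ (x₀ - t) := by
  have hκ : AEMeasurable κ (splitSol x₀ t) :=
    (aemeasurable_dirac.smul_measure _).add_measure (aemeasurable_dirac.smul_measure _)
  ext s hs
  rw [Measure.bind_apply hs hκ, splitSol, lintegral_add_measure, lintegral_smul_measure,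
    lintegral_smul_measure, lintegral_dirac, lintegral_dirac]
  rfl

theorem Vsp_splitSol (x₀ : ℝ) {t : ℝ} (ht : 0 ≤ t) :
    Vsp (splitSol x₀ t) = (1 / 2 : ℝ≥0∞) • Measure.dirac (x₀ + t, (1 : ℝ)) +
      (1 / 2 : ℝ≥0∞) • Measure.dirac (x₀ - t, (-1 : ℝ)) := by
  have hm (x : ℝ) : Measurable fun v : ℝ => (x, v) := measurable_prodMk_left
  have hδ (x v : ℝ) : (Measure.dirac v).map (fun v => (x, v)) = Measure.dirac (x, v) :=
    Measure.map_dirac' (hm x) v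
  rw [Vsp, bind_splitSol]
  rcases ht.eq_or_lt with rfl | ht
  · rw [add_zero, sub_zero, ← add_smul, ENNReal.add_halves, one_smul, nuSp_splitSol_zero,
      Measure.map_add _ _ (hm _), Measure.map_smul, Measure.map_smul, hδ, hδ]
  · rw [nuSp_splitSol_right x₀ ht, nuSp_splitSol_left x₀ ht, hδ, hδ]

theorem integral_half_dirac_add_half_dirac {α : Type*} [MeasurableSpace α]
    [MeasurableSingletonClass α] (a b : α) (g : α → ℝ) :
    ∫ p, g p ∂((1 / 2 : ℝ≥0∞) • Measure.dirac a + (1 / 2 : ℝ≥0∞) • Measure.dirac b) =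
      (g a + g b) / 2 := by
  have hi (c : α) : Integrable g ((1 / 2 : ℝ≥0∞) • Measure.dirac c) :=
    (integrable_dirac enorm_lt_top).smul_measure (by simp)
  rw [integral_add_measure (hi a) (hi b), integral_smul_measure, integral_smul_measure,
    integral_dirac, integral_dirac]
  simp only [one_div, ENNReal.toReal_inv, ENNReal.toReal_ofNat, smul_eq_mul]
  ring

theorem integral_Vsp_splitSol (x₀ : ℝ) {t : ℝ} (ht : 0 ≤ t) (g : ℝ → ℝ) :
    ∫ p : ℝ × ℝ, g p.1 * p.2 ∂(Vsp (splitSol x₀ t)) = (g (x₀ + t) - g (x₀ - t)) / 2 := by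
  rw [Vsp_splitSol x₀ ht, integral_half_dirac_add_half_dirac]
  ring

theorem isMDESol1_dirac (T x₀ : ℝ) : IsMDESol1 T Vsp (fun _ : ℝ => Measure.dirac x₀) := by
  intro f _ _
  have h : ∫ p : ℝ × ℝ, deriv f p.1 * p.2 ∂(Vsp (Measure.dirac x₀)) = 0 := by
    rw [← splitSol_zero, integral_Vsp_splitSol x₀ le_rfl]
    simp
  simp [h]

theorem isMDESol1_splitSol (T x₀ : ℝ) : IsMDESol1 T Vsp (splitSol x₀) := by
  intro f hf _
  have hd : Differentiable ℝ f := hf.differentiable (by simp)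
  have hc : Continuous (deriv f) := hf.continuous_deriv (by simp)
  have hv (t : ℝ) : EqOn (fun s => ∫ p : ℝ × ℝ, deriv f p.1 * p.2 ∂(Vsp (splitSol x₀ s)))
      (fun s => (deriv f (x₀ + s) - deriv f (x₀ - s)) / 2) (Icc 0 t) :=
    fun s hs => integral_Vsp_splitSol x₀ hs.1 (deriv f)
  have hcv : Continuous fun s => (deriv f (x₀ + s) - deriv f (x₀ - s)) / 2 := by fun_prop
  refine ⟨(integrableOn_congr_fun (hv T) measurableSet_Icc).2 hcv.integrableOn_Icc, ?_⟩
  intro t ht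
  have hderiv (s : ℝ) : HasDerivAt (fun s => (f (x₀ + s) + f (x₀ - s)) / 2)
      ((deriv f (x₀ + s) - deriv f (x₀ - s)) / 2) s := by
    have h₁ := (hd (x₀ + s)).hasDerivAt.comp_const_add x₀ s
    have h₂ := (hd (x₀ - s)).hasDerivAt.comp_const_sub x₀ s
    rw [sub_eq_add_neg]
    exact (h₁.add h₂).div_const 2
  rw [setIntegral_congr_fun measurableSet_Icc (hv t), integral_Icc_eq_integral_Ioc,
    ← intervalIntegral.integral_of_le ht.1,
    intervalIntegral.integral_eq_sub_of_hasDerivAt (fun s _ => hderiv s)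
      (hcv.intervalIntegrable _ _),
    splitSol, splitSol, integral_half_dirac_add_half_dirac, integral_half_dirac_add_half_dirac]

theorem splitSol_ne_dirac (x₀ : ℝ) {t : ℝ} (ht : t ≠ 0) : splitSol x₀ t ≠ Measure.dirac x₀ := by
  intro h
  have h' := congrArg (fun m : Measure ℝ => m {x₀}) h
  simp [splitSol_apply, indicator, ht] at h'

/-- Example `ex1`, non-uniqueness for the splitting-particle MDE: both
the stationary curve `μ¹_t = δ_{x₀}` and the splitting curve
`μ²_t = (1/2) δ_{x₀+t} + (1/2) δ_{x₀-t}` solve the MDE `μ̇_t = V[μ_t]` for the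
splitting-particle PVF, with initial datum `δ_{x₀}`; in particular solutions are not
unique. -/
theorem splitting_particle_nonuniqueness (T : ℝ) (hT : 0 < T) (x₀ : ℝ) :
    IsMDESol1 T Vsp (fun _ : ℝ => Measure.dirac x₀) ∧
    IsMDESol1 T Vsp (splitSol x₀) ∧
    splitSol x₀ 0 = Measure.dirac x₀ ∧
    ∃ t ∈ Icc (0 : ℝ) T, splitSol x₀ t ≠ Measure.dirac x₀ := by
  exact ⟨isMDESol1_dirac T x₀, isMDESol1_splitSol T x₀, splitSol_zero x₀,
    T, right_mem_Icc.2 hT.le, splitSol_ne_dirac x₀ hT.ne'⟩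

end
end

section
/- Splitting of a uniform distribution. Let V be the splitting-particle probability vector field on ℝ, let a < b and let μ₀ = (1/(b−a))·𝓛¹restricted to [a,b], where 𝓛¹ is the Lebesgue measure. Then the curve defined for t ∈ [0,T] by μ_t = (1/(b−a))·(𝓛¹ restricted to [a−t, (a+b)/2 − t] + 𝓛¹ restricted to [(a+b)/2 + t, b+t]) is a solution of the MDE μ̇_t = V[μ_t] with initial datum μ₀. -/
open MeasureTheory Set Filter Topology Metric
open scoped ENNReal NNReal Classical

noncomputable section

/-- The splitting of the uniform distribution on `[a,b]`:
`μ_t = (b-a)⁻¹ (𝓛¹|[a-t,(a+b)/2-t] + 𝓛¹|[(a+b)/2+t,b+t])`. -/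
def unifSplitSol (a b t : ℝ) : Measure ℝ :=
  (ENNReal.ofReal (b - a))⁻¹ •
    (volume.restrict (Icc (a - t) ((a + b) / 2 - t)) +
      volume.restrict (Icc ((a + b) / 2 + t) (b + t)))

theorem measurable_prodMk_sign (c : ℝ) :
    Measurable fun x : ℝ => (x, if x < c then (-1 : ℝ) else 1) :=
  measurable_id.prodMk (Measurable.ite measurableSet_Iio measurable_const measurable_const)

/-- When `B(μ)` is not an atom, the splitting-particle PVF is deterministic. -/
theorem Vsp_eq_map {μ : Measure ℝ} (h : μ {Bsp μ} = 0) :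
    Vsp μ = μ.map fun x => (x, if x < Bsp μ then (-1 : ℝ) else 1) := by
  rw [← Measure.bind_dirac_eq_map _ (measurable_prodMk_sign _)]
  refine Measure.bind_congr_right ?_
  have hne : ∀ᵐ x ∂μ, x ≠ Bsp μ := by
    simpa [ae_iff] using h
  filter_upwards [hne] with x hx
  rcases lt_or_gt_of_ne hx with hlt | hgt
  · simp [nuSp, hlt, Measure.map_dirac' measurable_prodMk_left]
  · simp [nuSp, hgt, hgt.not_gt, Measure.map_dirac' measurable_prodMk_left]

theorem unifSplitSol_singleton {a b : ℝ} (t x : ℝ) : unifSplitSol a b t {x} = 0 := by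
  simp [unifSplitSol]

theorem unifSplitSol_Iic_le_half {a b t : ℝ} (hab : a < b) (x : ℝ) (hx : x ≤ (a + b) / 2 + t) :
    unifSplitSol a b t (Iic x) ≤ 1 / 2 := by
  have hleft : volume.restrict (Icc (a - t) ((a + b) / 2 - t)) (Iic x)
      ≤ ENNReal.ofReal ((b - a) / 2) := by
    refine (measure_mono (subset_univ _)).trans ?_
    rw [Measure.restrict_apply_univ, Real.volume_Icc]
    exact ENNReal.ofReal_le_ofReal (by linarith)
  have hright : volume.restrict (Icc ((a + b) / 2 + t) (b + t)) (Iic x) = 0 := by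
    rw [Measure.restrict_apply measurableSet_Iic]
    refine measure_mono_null (t := {(a + b) / 2 + t}) ?_ (by simp)
    rintro y ⟨hy, hy', -⟩
    exact le_antisymm (le_trans hy hx) hy'
  have hpos : 0 < b - a := sub_pos.2 hab
  calc unifSplitSol a b t (Iic x)
      ≤ (ENNReal.ofReal (b - a))⁻¹ * ENNReal.ofReal ((b - a) / 2) := by
        simp only [unifSplitSol, Measure.smul_apply, Measure.add_apply, hright, add_zero,
          smul_eq_mul]
        gcongr
    _ = 1 / 2 := by
        rw [← ENNReal.ofReal_inv_of_pos hpos, ← ENNReal.ofReal_mul (by positivity)]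
        rw [show (b - a)⁻¹ * ((b - a) / 2) = 2⁻¹ by field_simp,
          ENNReal.ofReal_inv_of_pos two_pos]
        simp

theorem half_lt_unifSplitSol_Iic {a b t : ℝ} (hab : a < b) (ht : 0 ≤ t) (x : ℝ)
    (hx : (a + b) / 2 + t < x) : 1 / 2 < unifSplitSol a b t (Iic x) := by
  have hpos : 0 < b - a := sub_pos.2 hab
  have hleft : volume.restrict (Icc (a - t) ((a + b) / 2 - t)) (Iic x)
      = ENNReal.ofReal ((b - a) / 2) := by
    rw [Measure.restrict_apply measurableSet_Iic, inter_eq_right.2, Real.volume_Icc]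
    · congr 1; ring
    · exact fun y hy => hy.2.trans (by linarith)
  have hright : volume.restrict (Icc ((a + b) / 2 + t) (b + t)) (Iic x)
      = ENNReal.ofReal (min x (b + t) - ((a + b) / 2 + t)) := by
    have hinter : Iic x ∩ Icc ((a + b) / 2 + t) (b + t) =
        Icc ((a + b) / 2 + t) (min x (b + t)) := by
      ext y
      simp only [mem_inter_iff, mem_Iic, mem_Icc, le_min_iff]
      tauto
    rw [Measure.restrict_apply measurableSet_Iic, hinter, Real.volume_Icc]
  have hmin : (a + b) / 2 + t < min x (b + t) := lt_min hx (by linarith)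
  simp only [unifSplitSol, Measure.smul_apply, Measure.add_apply, hleft, hright, smul_eq_mul]
  rw [← ENNReal.ofReal_inv_of_pos hpos, ← ENNReal.ofReal_add (by positivity) (by linarith),
    ← ENNReal.ofReal_mul (by positivity),
    show (1 / 2 : ℝ≥0∞) = ENNReal.ofReal ((b - a)⁻¹ * ((b - a) / 2)) by
      rw [show (b - a)⁻¹ * ((b - a) / 2) = 2⁻¹ by field_simp, ENNReal.ofReal_inv_of_pos two_pos]
      simp]
  have hinv : 0 < (b - a)⁻¹ := inv_pos.2 hpos
  refine (ENNReal.ofReal_lt_ofReal_iff (mul_pos hinv (by linarith))).2 ?_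
  exact mul_lt_mul_of_pos_left (by linarith) hinv

theorem Bsp_unifSplitSol {a b t : ℝ} (hab : a < b) (ht : 0 ≤ t) :
    Bsp (unifSplitSol a b t) = (a + b) / 2 + t := by
  have hset : {x : ℝ | unifSplitSol a b t (Iic x) ≤ 1 / 2} = Iic ((a + b) / 2 + t) := by
    ext x
    refine ⟨fun h => ?_, unifSplitSol_Iic_le_half hab x⟩
    by_contra hx
    exact (half_lt_unifSplitSol_Iic hab ht x (not_le.1 hx)).not_ge h
  rw [Bsp, hset, csSup_Iic]

theorem integral_unifSplitSol {a b t : ℝ} (hab : a < b) {g : ℝ → ℝ}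
    (hg₁ : IntegrableOn g (Icc (a - t) ((a + b) / 2 - t)))
    (hg₂ : IntegrableOn g (Icc ((a + b) / 2 + t) (b + t))) :
    ∫ x, g x ∂(unifSplitSol a b t) =
      (b - a)⁻¹ * ((∫ x in (a - t)..((a + b) / 2 - t), g x) +
        ∫ x in ((a + b) / 2 + t)..(b + t), g x) := by
  rw [unifSplitSol, integral_smul_measure, integral_add_measure hg₁ hg₂,
    intervalIntegral.integral_of_le (by linarith), intervalIntegral.integral_of_le (by linarith),
    integral_Icc_eq_integral_Ioc, integral_Icc_eq_integral_Ioc, ENNReal.toReal_inv,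
    ENNReal.toReal_ofReal (sub_pos.2 hab).le, smul_eq_mul]

theorem integral_Vsp_unifSplitSol {a b t : ℝ} (hab : a < b) (ht : 0 ≤ t) {f : ℝ → ℝ}
    (hf : ContDiff ℝ 1 f) :
    ∫ p : ℝ × ℝ, deriv f p.1 * p.2 ∂(Vsp (unifSplitSol a b t)) =
      (b - a)⁻¹ * (f (a - t) - f ((a + b) / 2 - t) + (f (b + t) - f ((a + b) / 2 + t))) := by
  have hf' : Continuous (deriv f) := hf.continuous_deriv le_rfl
  have hftc (u v : ℝ) : ∫ x in u..v, deriv f x = f v - f u :=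
    intervalIntegral.integral_deriv_eq_sub
      (fun x _ => (hf.differentiable one_ne_zero).differentiableAt) (hf'.intervalIntegrable u v)
  set m := (a + b) / 2 with hm
  have hleft : ∀ᵐ x : ℝ, x ∈ Icc (a - t) (m - t) →
      -deriv f x = deriv f x * (if x < m + t then (-1 : ℝ) else 1) := by
    have hne : ∀ᵐ x : ℝ, x ≠ m + t := by simp [ae_iff]
    filter_upwards [hne] with x hx hmem
    have hlt : x < m + t := lt_of_le_of_ne (hmem.2.trans (by linarith)) hx
    simp [hlt]
  have hright : EqOn (deriv f) (fun x => deriv f x * (if x < m + t then (-1 : ℝ) else 1))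
      (Icc (m + t) (b + t)) := by
    intro x hx
    simp [hx.1.not_gt]
  rw [Vsp_eq_map (unifSplitSol_singleton _ _), Bsp_unifSplitSol hab ht,
    integral_map (measurable_prodMk_sign _).aemeasurable
      (by exact ((hf'.comp continuous_fst).mul continuous_snd).aestronglyMeasurable),
    integral_unifSplitSol hab
      (hf'.neg.integrableOn_Icc.congr_fun_ae ((ae_restrict_iff' measurableSet_Icc).2 hleft))
      (hf'.integrableOn_Icc.congr_fun hright measurableSet_Icc)]
  have hl : ∫ x in (a - t)..(m - t), deriv f x * (if x < m + t then (-1 : ℝ) else 1) =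
      f (a - t) - f (m - t) := by
    rw [← neg_sub (f (m - t)), ← hftc, ← intervalIntegral.integral_neg]
    refine (intervalIntegral.integral_congr_ae ?_).symm
    filter_upwards [hleft] with x hx hmem
    rw [uIoc_of_le (by linarith)] at hmem
    exact hx (Ioc_subset_Icc_self hmem)
  have hr : ∫ x in (m + t)..(b + t), deriv f x * (if x < m + t then (-1 : ℝ) else 1) =
      f (b + t) - f (m + t) := by
    rw [← hftc]
    refine (intervalIntegral.integral_congr ?_).symm
    rwa [uIcc_of_le (by linarith)]
  rw [hl, hr]

theorem integral_unifSplitSol_sub {a b t : ℝ} (hab : a < b) {f : ℝ → ℝ} (hf : Continuous f) :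
    (∫ x, f x ∂(unifSplitSol a b t)) - (∫ x, f x ∂(unifSplitSol a b 0)) =
      ∫ s in (0 : ℝ)..t, (b - a)⁻¹ *
        (f (a - s) - f ((a + b) / 2 - s) + (f (b + s) - f ((a + b) / 2 + s))) := by
  have hint (u v : ℝ) : IntervalIntegrable f volume u v := hf.intervalIntegrable u v
  set m := (a + b) / 2 with hm
  rw [integral_unifSplitSol hab hf.integrableOn_Icc hf.integrableOn_Icc,
    integral_unifSplitSol hab hf.integrableOn_Icc hf.integrableOn_Icc,
    intervalIntegral.integral_const_mul, ← mul_sub]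
  congr 1
  rw [intervalIntegral.integral_add, intervalIntegral.integral_sub, intervalIntegral.integral_sub]
  · simp only [intervalIntegral.integral_comp_sub_left, intervalIntegral.integral_comp_add_left,
      sub_zero, add_zero]
    rw [← intervalIntegral.integral_interval_sub_left (hint 0 (m - t)) (hint 0 (a - t)),
      ← intervalIntegral.integral_interval_sub_left (hint 0 (b + t)) (hint 0 (m + t)),
      ← intervalIntegral.integral_interval_sub_left (hint 0 m) (hint 0 a),
      ← intervalIntegral.integral_interval_sub_left (hint 0 b) (hint 0 m),
      ← intervalIntegral.integral_interval_sub_left (hint 0 a) (hint 0 (a - t)),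
      ← intervalIntegral.integral_interval_sub_left (hint 0 m) (hint 0 (m - t)),
      ← intervalIntegral.integral_interval_sub_left (hint 0 (b + t)) (hint 0 b),
      ← intervalIntegral.integral_interval_sub_left (hint 0 (m + t)) (hint 0 m)]
    ring
  all_goals exact Continuous.intervalIntegrable (by fun_prop) _ _

theorem unifSplitSol_zero {a b : ℝ} (hab : a < b) :
    unifSplitSol a b 0 = (ENNReal.ofReal (b - a))⁻¹ • volume.restrict (Icc a b) := by
  have hm : a ≤ (a + b) / 2 := by linarith
  have hm' : (a + b) / 2 ≤ b := by linarith
  simp only [unifSplitSol, sub_zero, add_zero]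
  rw [← Icc_union_Icc_eq_Icc hm hm', ← Measure.restrict_congr_set
    (Ioc_ae_eq_Icc (a := (a + b) / 2) (b := b)), ← Measure.restrict_union _ measurableSet_Ioc,
    Icc_union_Ioc_eq_Icc hm hm', Icc_union_Icc_eq_Icc hm hm']
  exact disjoint_left.2 fun x hx hx' => hx'.1.not_ge hx.2

/-- Example `ex1`, splitting of a uniform distribution: the curve
`μ_t = (b-a)⁻¹(𝓛¹|[a-t,(a+b)/2-t] + 𝓛¹|[(a+b)/2+t,b+t])` is a solution of the MDE
`μ̇_t = V[μ_t]` for the splitting-particle PVF, with initial datum the uniform distribution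
on `[a,b]`. -/
theorem splitting_particle_uniform (T : ℝ) (hT : 0 < T) (a b : ℝ) (hab : a < b) :
    IsMDESol1 T Vsp (unifSplitSol a b) ∧
    unifSplitSol a b 0 = (ENNReal.ofReal (b - a))⁻¹ • volume.restrict (Icc a b) := by
  refine ⟨fun f hf _ => ?_, unifSplitSol_zero hab⟩
  have hf₁ : ContDiff ℝ 1 f := hf.of_le (by exact_mod_cast le_top)
  have hfc : Continuous f := hf.continuous
  have hV (s : ℝ) (hs : s ∈ Icc (0 : ℝ) T) := integral_Vsp_unifSplitSol hab hs.1 hf₁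
  refine ⟨?_, fun t ht => ?_⟩
  · refine IntegrableOn.congr_fun (Continuous.integrableOn_Icc ?_)
      (fun s hs => (hV s hs).symm) measurableSet_Icc
    fun_prop
  · rw [integral_unifSplitSol_sub hab hfc, intervalIntegral.integral_of_le ht.1,
      ← integral_Icc_eq_integral_Ioc]
    exact setIntegral_congr_fun measurableSet_Icc
      fun s hs => (hV s ⟨hs.1, hs.2.trans ht.2⟩).symm

end
end
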